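/- arXiv:math/0507293 — 7 statements merged into one kernel-verified Lean document; each statement's English description precedes it below -/
import Mathlib

section
/- As n → ∞, a_{n,1}/n! = e^{−2}·(1 − 2/n² − 10/(3n³) − 6/n⁴ − 154/(15n⁵)) + O(1/n⁶); in particular the coefficient of 1/n in the expansion of e²·a_{n,1}/n! is zero. -/
open Filter Asymptotics

/-- `a_{n,d}` for `d ≥ 1`: the number of permutations `π` of `{1,…,n}` (here realized as
permutations of `Fin n`) such that `|π(i+d) − π(i)| ≠ d` for all valid indices `i`. -/
noncomputable def A (n d : ℕ) : ℕ :=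
  Set.ncard {π : Equiv.Perm (Fin n) |
    ∀ i : Fin n, ∀ h : (i : ℕ) + d < n,
      (((π ⟨(i : ℕ) + d, h⟩ : Fin n) : ℤ) - ((π i : Fin n) : ℤ)).natAbs ≠ d}

/-- The entries of `π` at the positions `i` and `i + 1` differ by exactly one. -/
def IsAdjacency {n : ℕ} (π : Equiv.Perm (Fin n)) (i : ℕ) : Prop :=
  ∃ h : i + 1 < n, (π ⟨i + 1, h⟩ : ℕ) = π ⟨i, by omega⟩ + 1 ∨
    (π ⟨i, by omega⟩ : ℕ) = π ⟨i + 1, h⟩ + 1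

open Classical in
/-- The number of permutations of `Fin n` having an adjacency at every position of `S`. -/
noncomputable def adjacencyCount (n : ℕ) (S : Finset ℕ) : ℕ :=
  Fintype.card {π : Equiv.Perm (Fin n) // ∀ i ∈ S, IsAdjacency π i}

/-- Append the value `v` to the sequence of values of `σ`, shifting the values `≥ v` up. -/
def appendValue {n : ℕ} (v : Fin (n + 1)) (σ : Equiv.Perm (Fin n)) : Equiv.Perm (Fin (n + 1)) :=
  finSuccEquivLast.trans ((Equiv.optionCongr σ).trans (finSuccEquiv' v).symm)

lemma appendValue_last {n : ℕ} (v : Fin (n + 1)) (σ : Equiv.Perm (Fin n)) :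
    appendValue v σ (Fin.last n) = v := by
  simp [appendValue]

lemma appendValue_castSucc {n : ℕ} (v : Fin (n + 1)) (σ : Equiv.Perm (Fin n)) (i : Fin n) :
    appendValue v σ i.castSucc = v.succAbove (σ i) := by
  simp [appendValue]

lemma appendValue_bijective (n : ℕ) :
    Function.Bijective fun p : Fin (n + 1) × Equiv.Perm (Fin n) => appendValue p.1 p.2 := by
  rw [Fintype.bijective_iff_injective_and_card]
  refine ⟨?_, by simp [Fintype.card_perm, Nat.factorial_succ]⟩
  rintro ⟨v, σ⟩ ⟨v', σ'⟩ h
  have hv : v = v' := by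
    simpa [appendValue_last] using congrArg (fun π => π (Fin.last n)) h
  subst hv
  refine Prod.ext rfl (Equiv.ext fun i => ?_)
  have hi := congrArg (fun π => π i.castSucc) h
  simpa [appendValue_castSucc] using hi

lemma val_succAbove {n : ℕ} (v : Fin (n + 1)) (a : Fin n) :
    (v.succAbove a : ℕ) = if (a : ℕ) < v then (a : ℕ) else a + 1 := by
  simp only [Fin.succAbove, Fin.lt_def, Fin.val_castSucc]
  split_ifs <;> simp

/-- The larger of the entries at the positions `i` and `i + 1`. -/
def upperEntry {n : ℕ} (σ : Equiv.Perm (Fin n)) (i : ℕ) : ℕ :=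
  if h : i + 1 < n then max (σ ⟨i, by omega⟩ : ℕ) (σ ⟨i + 1, h⟩) else 0

lemma isAdjacency_appendValue_iff {n : ℕ} (v : Fin (n + 1)) (σ : Equiv.Perm (Fin n)) {i : ℕ}
    (hi : i + 1 < n) :
    IsAdjacency (appendValue v σ) i ↔ IsAdjacency σ i ∧ (v : ℕ) ≠ upperEntry σ i := by
  have h1 : (appendValue v σ ⟨i, by omega⟩ : ℕ) = v.succAbove (σ ⟨i, by omega⟩) :=
    congrArg Fin.val (appendValue_castSucc v σ ⟨i, by omega⟩)
  have h2 : (appendValue v σ ⟨i + 1, by omega⟩ : ℕ) = v.succAbove (σ ⟨i + 1, hi⟩) :=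
    congrArg Fin.val (appendValue_castSucc v σ ⟨i + 1, hi⟩)
  have hne : (σ ⟨i, by omega⟩ : ℕ) ≠ σ ⟨i + 1, hi⟩ := by
    simp [Fin.val_inj]
  rw [val_succAbove] at h1 h2
  simp only [IsAdjacency, upperEntry, hi, h1, h2, exists_prop_of_true, dif_pos,
    (by omega : i + 1 < n + 1)]
  rcases max_cases (σ ⟨i, by omega⟩ : ℕ) (σ ⟨i + 1, hi⟩) with ⟨h, -⟩ | ⟨h, -⟩ <;>
    split_ifs <;> omega

lemma isAdjacency_appendValue_last_iff {n : ℕ} (v : Fin (n + 2)) (σ : Equiv.Perm (Fin (n + 1))) :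
    IsAdjacency (appendValue v σ) n ↔
      (v : ℕ) = σ (Fin.last n) ∨ (v : ℕ) = σ (Fin.last n) + 1 := by
  have h1 : (appendValue v σ ⟨n, by omega⟩ : ℕ) = v.succAbove (σ (Fin.last n)) :=
    congrArg Fin.val (appendValue_castSucc v σ (Fin.last n))
  have h2 : (appendValue v σ ⟨n + 1, by omega⟩ : ℕ) = v :=
    congrArg Fin.val (appendValue_last v σ)
  rw [val_succAbove] at h1
  simp only [IsAdjacency, h1, h2, exists_prop_of_true, (by omega : n + 1 < n + 2)]
  split_ifs <;> omega

lemma upperEntry_injOn {n : ℕ} (σ : Equiv.Perm (Fin n)) {i j : ℕ} (hi : IsAdjacency σ i)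
    (hj : IsAdjacency σ j) (h : upperEntry σ i = upperEntry σ j) : i = j := by
  obtain ⟨hi', hi⟩ := hi
  obtain ⟨hj', hj⟩ := hj
  simp only [upperEntry, hi', hj', dif_pos] at h
  have key : ∀ a b (ha : a < n) (hb : b < n), (σ ⟨a, ha⟩ : ℕ) = σ ⟨b, hb⟩ → a = b := by
    intro a b ha hb hab
    simpa [Fin.val_inj] using hab
  have k1 := key i j (by omega) (by omega)
  have k2 := key i (j + 1) (by omega) (by omega)
  have k3 := key (i + 1) j (by omega) (by omega)
  have k4 := key (i + 1) (j + 1) (by omega) (by omega)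
  omega

lemma upperEntry_lt {n : ℕ} (σ : Equiv.Perm (Fin n)) {i : ℕ} (hi : i + 1 < n) :
    upperEntry σ i < n := by
  simp only [upperEntry, hi, dif_pos]
  exact max_lt (Fin.is_lt _) (Fin.is_lt _)

open Classical in
lemma adjacencyCount_succ (n : ℕ) (S : Finset ℕ) (c : ℕ)
    (hc : ∀ σ : Equiv.Perm (Fin n), Fintype.card
      {v : Fin (n + 1) // ∀ i ∈ S, IsAdjacency (appendValue v σ) i} =
        if ∀ i ∈ S, i + 1 < n → IsAdjacency σ i then c else 0) :
    adjacencyCount (n + 1) S = c * adjacencyCount n (S.filter fun i => i + 1 < n) := by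
  have e : {p : Fin (n + 1) × Equiv.Perm (Fin n) // ∀ i ∈ S, IsAdjacency (appendValue p.1 p.2) i} ≃
      {π : Equiv.Perm (Fin (n + 1)) // ∀ i ∈ S, IsAdjacency π i} :=
    (Equiv.ofBijective _ (appendValue_bijective n)).subtypeEquiv fun p => by simp
  rw [adjacencyCount, ← Fintype.card_congr e, Fintype.card_subtype, Finset.card_filter,
    Fintype.sum_prod_type_right]
  simp_rw [← Finset.card_filter, ← Fintype.card_subtype, hc]
  rw [← Finset.sum_filter, Finset.sum_const, adjacencyCount, Fintype.card_subtype, smul_eq_mul,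
    mul_comm]
  simp [Finset.mem_filter]

lemma card_subtype_fin (n : ℕ) (P : ℕ → Prop) [DecidablePred P]
    [Fintype {v : Fin n // P v}] :
    Fintype.card {v : Fin n // P v} = ((Finset.range n).filter P).card := by
  rw [Fintype.card_subtype, Finset.card_filter, Finset.card_filter,
    Fin.sum_univ_eq_sum_range fun v => if P v then 1 else 0]

open Classical in
lemma adjacencyCount_succ_of_lt {n : ℕ} {S : Finset ℕ} (hS : ∀ i ∈ S, i + 1 < n) :
    adjacencyCount (n + 1) S = (n + 1 - S.card) * adjacencyCount n S := by
  have hfilter : (S.filter fun i => i + 1 < n) = S := Finset.filter_true_of_mem hS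
  rw [adjacencyCount_succ n S (n + 1 - S.card), hfilter]
  intro σ
  split_ifs with h
  · have hiff : ∀ v : Fin (n + 1), (∀ i ∈ S, IsAdjacency (appendValue v σ) i) ↔
        (v : ℕ) ∉ S.image (upperEntry σ) := by
      intro v
      simp only [Finset.mem_image, not_exists, not_and]
      refine forall₂_congr fun i hi => ?_
      rw [isAdjacency_appendValue_iff v σ (hS i hi)]
      exact ⟨fun H => H.2.symm, fun H => ⟨h i hi (hS i hi), Ne.symm H⟩⟩
    simp_rw [hiff]
    rw [card_subtype_fin (n + 1) (fun v => v ∉ S.image (upperEntry σ)), ← Finset.sdiff_eq_filter,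
      Finset.card_sdiff_of_subset, Finset.card_range, Finset.card_image_of_injOn]
    · exact fun i hi j hj hij => upperEntry_injOn σ (h i hi (hS i hi)) (h j hj (hS j hj)) hij
    · intro v hv
      obtain ⟨i, hi, rfl⟩ := Finset.mem_image.1 hv
      exact Finset.mem_range.2 ((upperEntry_lt σ (hS i hi)).trans (Nat.lt_succ_self n))
  · push Not at h
    obtain ⟨i, hi, hi', hadj⟩ := h
    rw [Fintype.card_eq_zero_iff]
    exact ⟨fun v => hadj ((isAdjacency_appendValue_iff v.1 σ hi').1 (v.2 i hi)).1⟩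

lemma upperEntry_ne_last {n : ℕ} (σ : Equiv.Perm (Fin (n + 1))) {i : ℕ} (hi : i + 1 < n)
    (h : IsAdjacency σ i) :
    upperEntry σ i ≠ σ (Fin.last n) ∧ upperEntry σ i ≠ σ (Fin.last n) + 1 := by
  have key : ∀ a (ha : a < n), (σ ⟨a, by omega⟩ : ℕ) ≠ σ (Fin.last n) := by
    intro a ha hab
    have := congrArg Fin.val (σ.injective (Fin.ext hab))
    simp at this
    omega
  obtain ⟨h', h⟩ := h
  simp only [upperEntry, h', dif_pos]
  have k1 := key i (by omega)
  have k2 := key (i + 1) hi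
  omega

lemma upperEntry_eq_last_or {n : ℕ} (σ : Equiv.Perm (Fin (n + 2))) (h : IsAdjacency σ n) :
    upperEntry σ n = σ (Fin.last (n + 1)) ∨ upperEntry σ n = σ (Fin.last (n + 1)) + 1 := by
  obtain ⟨h', h⟩ := h
  have hl : (σ ⟨n + 1, h'⟩ : ℕ) = σ (Fin.last (n + 1)) := rfl
  simp only [upperEntry, h', dif_pos]
  omega

open Classical in
lemma adjacencyCount_insert {n : ℕ} {S : Finset ℕ} (hS : ∀ i ∈ S, i < n) :
    adjacencyCount (n + 2) (insert n S) =
      (if ∃ j ∈ S, j + 1 = n then 1 else 2) * adjacencyCount (n + 1) S := by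
  have hfilter : ((insert n S).filter fun i => i + 1 < n + 1) = S := by
    ext i
    simp only [Finset.mem_filter, Finset.mem_insert]
    constructor
    · rintro ⟨rfl | h, h'⟩
      · omega
      · exact h
    · exact fun h => ⟨Or.inr h, by have := hS i h; omega⟩
  rw [adjacencyCount_succ (n + 1) (insert n S) (if ∃ j ∈ S, j + 1 = n then 1 else 2), hfilter]
  intro σ
  split_ifs with h hj
  · obtain ⟨j, hjS, rfl⟩ := hj
    have hσ : ∀ i ∈ S, IsAdjacency σ i := fun i hi =>
      h i (Finset.mem_insert_of_mem hi) (by have := hS i hi; omega)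
    obtain ⟨b, hb, hbu⟩ : ∃ b : ℕ, b < j + 3 ∧ ∀ v : ℕ, ((v = σ (Fin.last (j + 1)) ∨
        v = σ (Fin.last (j + 1)) + 1) ∧ v ≠ upperEntry σ j) ↔ v = b := by
      have hlt := (σ (Fin.last (j + 1))).isLt
      rcases upperEntry_eq_last_or σ (hσ j hjS) with hu | hu
      · exact ⟨σ (Fin.last (j + 1)) + 1, by omega, fun v => by omega⟩
      · exact ⟨σ (Fin.last (j + 1)), by omega, fun v => by omega⟩
    rw [Fintype.card_eq_one_iff]
    have hiff : ∀ v : Fin (j + 3), (∀ i ∈ insert (j + 1) S, IsAdjacency (appendValue v σ) i) ↔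
        (v : ℕ) = b := by
      intro v
      rw [Finset.forall_mem_insert, isAdjacency_appendValue_last_iff, ← hbu]
      refine and_congr_right fun hv => ⟨fun H =>
        ((isAdjacency_appendValue_iff v σ (by omega)).1 (H j hjS)).2, fun H i hi => ?_⟩
      have hin := hS i hi
      refine (isAdjacency_appendValue_iff v σ (by omega)).2 ⟨hσ i hi, ?_⟩
      rcases (by omega : i = j ∨ i + 1 < j + 1) with rfl | hij
      · exact H
      · have := upperEntry_ne_last σ hij (hσ i hi)
        omega
    exact ⟨⟨⟨b, hb⟩, (hiff _).2 rfl⟩, fun v => Subtype.ext (Fin.ext ((hiff _).1 v.2))⟩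
  · have hσ : ∀ i ∈ S, IsAdjacency σ i := fun i hi =>
      h i (Finset.mem_insert_of_mem hi) (by have := hS i hi; omega)
    have hiff : ∀ v : Fin (n + 2), (∀ i ∈ insert n S, IsAdjacency (appendValue v σ) i) ↔
        v = (σ (Fin.last n)).castSucc ∨ v = (σ (Fin.last n)).succ := by
      intro v
      rw [Finset.forall_mem_insert, isAdjacency_appendValue_last_iff]
      simp only [Fin.ext_iff, Fin.val_castSucc, Fin.val_succ, and_iff_left_iff_imp]
      intro hv i hi
      have hin := hS i hi
      have hne : i + 1 ≠ n := fun hi' => hj ⟨i, hi, hi'⟩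
      have := upperEntry_ne_last σ (by omega) (hσ i hi)
      exact (isAdjacency_appendValue_iff v σ (by omega)).2 ⟨hσ i hi, by omega⟩
    simp_rw [hiff]
    rw [Fintype.card_subtype, Finset.filter_or, Finset.filter_eq', Finset.filter_eq']
    simp only [Finset.mem_univ, if_true, ← Finset.insert_eq]
    exact Finset.card_pair (Fin.castSucc_lt_succ).ne
  · push Not at h
    obtain ⟨i, hi, hi', hadj⟩ := h
    rw [Fintype.card_eq_zero_iff]
    exact ⟨fun v => hadj ((isAdjacency_appendValue_iff v.1 σ hi').1 (v.2 i hi)).1⟩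

/-- `2` to the number of maximal runs of consecutive elements of `S`. -/
def runWeight (S : Finset ℕ) : ℕ :=
  2 ^ (S.filter fun i => ∀ j ∈ S, j + 1 ≠ i).card

lemma runWeight_insert {n : ℕ} {S : Finset ℕ} (hS : ∀ i ∈ S, i < n) :
    runWeight (insert n S) = (if ∃ j ∈ S, j + 1 = n then 1 else 2) * runWeight S := by
  have hn : n ∉ S := fun h => lt_irrefl _ (hS n h)
  have hold : (S.filter fun i => ∀ j ∈ insert n S, j + 1 ≠ i) =
      S.filter fun i => ∀ j ∈ S, j + 1 ≠ i := by
    refine Finset.filter_congr fun i hi => ?_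
    rw [Finset.forall_mem_insert, and_iff_right]
    have := hS i hi
    omega
  rw [runWeight, runWeight, Finset.filter_insert, hold]
  split_ifs with h h' h'
  · obtain ⟨j, hj, hjn⟩ := h'
    exact absurd hjn (h j (Finset.mem_insert_of_mem hj))
  · rw [Finset.card_insert_of_notMem (by simp [hn]), pow_succ, mul_comm]
  · rw [one_mul]
  · refine absurd ?_ h
    rw [Finset.forall_mem_insert]
    exact ⟨by omega, fun j hj hjn => h' ⟨j, hj, hjn⟩⟩

lemma adjacencyCount_eq (n : ℕ) (S : Finset ℕ) (hS : ∀ i ∈ S, i < n) :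
    adjacencyCount (n + 1) S = (n + 1 - S.card).factorial * runWeight S := by
  induction n generalizing S with
  | zero =>
    obtain rfl : S = ∅ := Finset.eq_empty_of_forall_notMem fun i hi => by simpa using hS i hi
    simp [adjacencyCount, runWeight]
  | succ n ih =>
    have hcard : ∀ T : Finset ℕ, (∀ i ∈ T, i < n) → T.card ≤ n := fun T hT => by
      simpa using Finset.card_le_card (t := Finset.range n) fun i hi =>
        Finset.mem_range.2 (hT i hi)
    by_cases hn : n ∈ S
    · have hS' : ∀ i ∈ S.erase n, i < n := fun i hi => by
        have h1 := hS i (Finset.mem_of_mem_erase hi)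
        have h2 := Finset.ne_of_mem_erase hi
        omega
      rw [← Finset.insert_erase hn, adjacencyCount_insert hS', ih _ hS', runWeight_insert hS',
        Finset.card_insert_of_notMem (Finset.notMem_erase n S), Nat.add_sub_add_right]
      split_ifs <;> ring
    · have hS' : ∀ i ∈ S, i < n := fun i hi => by
        have h1 := hS i hi
        have h2 : i ≠ n := fun h => hn (h ▸ hi)
        omega
      rw [adjacencyCount_succ_of_lt (fun i hi => by have := hS' i hi; omega), ih S hS',
        Nat.sub_add_comm ((hcard S hS').trans (Nat.le_succ n)), Nat.factorial_succ, mul_assoc]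

open Classical in
lemma A_one_eq_sum_powerset (N : ℕ) :
    (A (N + 1) 1 : ℤ) =
      ∑ S ∈ (Finset.range N).powerset, (-1) ^ S.card * (adjacencyCount (N + 1) S : ℤ) := by
  have hA : A (N + 1) 1 =
      (Finset.univ.filter fun π : Equiv.Perm (Fin (N + 1)) =>
        (Finset.range N).filter (IsAdjacency π) = ∅).card := by
    rw [A, Set.ncard_eq_toFinset_card']
    congr 1
    ext π
    simp only [Set.mem_toFinset, Set.mem_ofPred_eq, Finset.mem_filter, Finset.mem_univ, true_and,
      Finset.filter_eq_empty_iff, Finset.mem_range]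
    constructor
    · rintro h i hi ⟨h', hadj⟩
      exact h ⟨i, by omega⟩ h' (by simp only; omega)
    · intro h i hi hadj
      refine h (x := i) (by omega) ⟨hi, ?_⟩
      simp only [Fin.eta]
      omega
  have hpow : ∀ π : Equiv.Perm (Fin (N + 1)),
      ((Finset.range N).filter (IsAdjacency π)).powerset =
        (Finset.range N).powerset.filter fun S => ∀ i ∈ S, IsAdjacency π i := by
    intro π
    ext S
    simp only [Finset.mem_powerset, Finset.mem_filter, Finset.subset_iff, ← forall_and]
  rw [hA, Finset.card_filter]
  push_cast
  simp_rw [← Finset.sum_powerset_neg_one_pow_card, hpow, Finset.sum_filter]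
  rw [Finset.sum_comm]
  refine Finset.sum_congr rfl fun S _ => ?_
  rw [adjacencyCount, Fintype.card_subtype, Finset.card_filter]
  push_cast
  rw [Finset.mul_sum]
  exact Finset.sum_congr rfl fun π _ => by split_ifs <;> simp

/-- The Delannoy-type numbers `[x^k] ((1 + x) / (1 - x))^m`. -/
def delannoyCoeff : ℕ → ℕ → ℕ
  | 0, 0 => 1
  | 0, _ + 1 => 0
  | _ + 1, 0 => 1
  | m + 1, k + 1 => delannoyCoeff m (k + 1) + delannoyCoeff (m + 1) k + delannoyCoeff m k

lemma delannoyCoeff_zero_right (m : ℕ) : delannoyCoeff m 0 = 1 := by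
  cases m <;> rw [delannoyCoeff]

lemma delannoyCoeff_succ_succ (m k : ℕ) : delannoyCoeff (m + 1) (k + 1) =
    delannoyCoeff m (k + 1) + delannoyCoeff (m + 1) k + delannoyCoeff m k := by
  rw [delannoyCoeff]

lemma sum_powersetCard_range_succ (f : Finset ℕ → ℕ) (N k : ℕ) :
    ∑ S ∈ (Finset.range (N + 1)).powersetCard (k + 1), f S =
      ∑ S ∈ (Finset.range N).powersetCard (k + 1), f S +
        ∑ S ∈ (Finset.range N).powersetCard k, f (insert N S) := by
  have hN : ∀ {j S}, S ∈ (Finset.range N).powersetCard j → N ∉ S := fun hS h =>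
    Finset.notMem_range_self ((Finset.mem_powersetCard.1 hS).1 h)
  rw [Finset.range_add_one, Finset.powersetCard_succ_insert Finset.notMem_range_self,
    Finset.sum_union, Finset.sum_image]
  · intro S hS T hT h
    rw [← Finset.erase_insert (hN hS), h, Finset.erase_insert (hN hT)]
  · rw [Finset.disjoint_left]
    intro S hS hS'
    obtain ⟨T, -, rfl⟩ := Finset.mem_image.1 hS'
    exact hN hS (Finset.mem_insert_self N T)

lemma sum_runWeight (N : ℕ) :
    (∀ m k, m + k = N + 1 →
      ∑ S ∈ (Finset.range N).powersetCard k, runWeight S = delannoyCoeff m k) ∧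
    ∀ m k, m + k = N → ∑ S ∈ (Finset.range N).powersetCard k, runWeight (insert N S) =
      delannoyCoeff (m + 1) k + delannoyCoeff m k := by
  induction N with
  | zero =>
    refine ⟨fun m k h => ?_, fun m k h => ?_⟩
    · rcases k with _ | k
      · simp [delannoyCoeff_zero_right, runWeight]
      · obtain ⟨rfl, rfl⟩ : m = 0 ∧ k = 0 := by omega
        simp [delannoyCoeff]
    · obtain ⟨rfl, rfl⟩ : m = 0 ∧ k = 0 := by omega
      simp [delannoyCoeff, runWeight, Finset.filter_singleton]
  | succ N ih =>
    have hmem : ∀ {j S}, S ∈ (Finset.range N).powersetCard j → ∀ i ∈ S, i < N := fun hS i hi =>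
      Finset.mem_range.1 ((Finset.mem_powersetCard.1 hS).1 hi)
    refine ⟨fun m k h => ?_, fun m k h => ?_⟩
    · rcases k with _ | k
      · simp [delannoyCoeff_zero_right, runWeight]
      · rcases m with _ | m
        · rw [Finset.powersetCard_eq_empty.2 (by simp; omega), Finset.sum_empty, delannoyCoeff]
        · rw [sum_powersetCard_range_succ, ih.1 m (k + 1) (by omega), ih.2 m k (by omega),
            delannoyCoeff_succ_succ, add_assoc]
    · rcases k with _ | k
      · simp [delannoyCoeff_zero_right, runWeight, Finset.filter_singleton]
      · have h1 : ∀ S ∈ (Finset.range N).powersetCard (k + 1),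
            runWeight (insert (N + 1) S) = 2 * runWeight S := fun S hS => by
          rw [runWeight_insert fun i hi => (hmem hS i hi).trans (Nat.lt_succ_self N), if_neg]
          rintro ⟨j, hj, hjN⟩
          have := hmem hS j hj
          omega
        have h2 : ∀ S ∈ (Finset.range N).powersetCard k,
            runWeight (insert (N + 1) (insert N S)) = runWeight (insert N S) := fun S hS => by
          rw [runWeight_insert, if_pos ⟨N, Finset.mem_insert_self N S, rfl⟩, one_mul]
          rw [Finset.forall_mem_insert]
          exact ⟨Nat.lt_succ_self N, fun i hi => (hmem hS i hi).trans (Nat.lt_succ_self N)⟩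
        rw [sum_powersetCard_range_succ, Finset.sum_congr rfl h1, Finset.sum_congr rfl h2,
          ← Finset.mul_sum, ih.1 m (k + 1) (by omega), ih.2 m k (by omega),
          delannoyCoeff_succ_succ]
        ring

lemma A_one_eq_sum (n : ℕ) :
    (A n 1 : ℤ) = ∑ k ∈ Finset.range (n + 1),
      (-1) ^ k * (delannoyCoeff (n - k) k : ℤ) * (n - k).factorial := by
  rcases n with _ | N
  · have h : A 0 1 = 1 := by
      rw [A, show {π : Equiv.Perm (Fin 0) | _} = Set.univ from
        Set.eq_univ_of_forall fun π i => i.elim0]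
      simp [Set.ncard_univ]
    simp [h, delannoyCoeff]
  · rw [A_one_eq_sum_powerset, Finset.sum_powerset, Finset.card_range,
      Finset.sum_range_succ _ (N + 1), Nat.sub_self, delannoyCoeff]
    simp only [Nat.cast_zero, mul_zero, zero_mul, add_zero]
    refine Finset.sum_congr rfl fun k hk => ?_
    rw [← (sum_runWeight N).1 (N + 1 - k) k (by have := Finset.mem_range.1 hk; omega)]
    push_cast
    rw [Finset.mul_sum, Finset.sum_mul]
    refine Finset.sum_congr rfl fun S hS => ?_
    obtain ⟨hSN, rfl⟩ := Finset.mem_powersetCard.1 hS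
    rw [adjacencyCount_eq N S fun i hi => Finset.mem_range.1 (hSN hi)]
    push_cast
    ring

section PowerSeries

open PowerSeries

/-- The power series `((1 - X) / (1 + X)) ^ m`. -/
noncomputable def delannoySeries (m : ℕ) : ℤ⟦X⟧ :=
  PowerSeries.mk fun k => (-1) ^ k * (delannoyCoeff m k : ℤ)

lemma delannoySeries_zero : delannoySeries 0 = 1 := by
  ext k
  rcases k with _ | k <;> simp [delannoySeries, delannoyCoeff, PowerSeries.coeff_one]

lemma one_add_X_mul_delannoySeries_succ (m : ℕ) :
    (1 + X) * delannoySeries (m + 1) = (1 - X) * delannoySeries m := by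
  ext k
  rw [add_mul, sub_mul, one_mul, one_mul, map_add, map_sub]
  rcases k with _ | k
  · simp [delannoySeries, delannoyCoeff_zero_right]
  · rw [coeff_succ_X_mul, coeff_succ_X_mul]
    simp only [delannoySeries, coeff_mk, delannoyCoeff_succ_succ]
    push_cast
    ring

lemma one_add_X_ne_zero : (1 + X : ℤ⟦X⟧) ≠ 0 := fun h => by
  simpa using congrArg (coeff 0) h

lemma delannoySeries_eq_pow (m : ℕ) : delannoySeries m = delannoySeries 1 ^ m := by
  induction m with
  | zero => rw [delannoySeries_zero, pow_zero]
  | succ m ih =>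
    refine mul_left_cancel₀ one_add_X_ne_zero ?_
    have h := one_add_X_mul_delannoySeries_succ 0
    rw [zero_add, delannoySeries_zero, mul_one] at h
    rw [one_add_X_mul_delannoySeries_succ, ih, pow_succ, mul_left_comm, h, mul_comm]

/-- The generating function `X (1 - X) / (1 + X)` of a single block. -/
noncomputable def blockSeries : ℤ⟦X⟧ := X * delannoySeries 1

/-- The sum of `m! w ^ m` over `m < N`, where `w` is the generating function of a block. -/
noncomputable def truncatedSeries (N : ℕ) : ℤ⟦X⟧ :=
  ∑ m ∈ Finset.range N, (m.factorial : ℤ⟦X⟧) * blockSeries ^ m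

lemma one_add_X_mul_blockSeries : (1 + X) * blockSeries = X * (1 - X) := by
  have h := one_add_X_mul_delannoySeries_succ 0
  rw [zero_add, delannoySeries_zero, mul_one] at h
  rw [blockSeries, mul_left_comm, h]

lemma coeff_factorial_mul_blockSeries_pow (m n : ℕ) :
    coeff n ((m.factorial : ℤ⟦X⟧) * blockSeries ^ m) =
      if m ≤ n then (-1) ^ (n - m) * (delannoyCoeff m (n - m) : ℤ) * m.factorial else 0 := by
  rw [blockSeries, mul_pow, ← delannoySeries_eq_pow, ← map_natCast (C (R := ℤ)),
    coeff_C_mul, coeff_X_pow_mul']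
  split_ifs
  · rw [delannoySeries, coeff_mk, mul_comm]
  · rw [mul_zero]

lemma coeff_truncatedSeries {n N : ℕ} (h : n < N) : coeff n (truncatedSeries N) = A n 1 := by
  rw [truncatedSeries, map_sum, A_one_eq_sum,
    ← Finset.sum_range_reflect (fun k => (-1) ^ k * (delannoyCoeff (n - k) k : ℤ) * _)]
  simp_rw [coeff_factorial_mul_blockSeries_pow]
  rw [← Finset.sum_subset (Finset.range_subset_range.2 (Nat.succ_le_of_lt h))]
  · refine Finset.sum_congr rfl fun m hm => ?_
    have hm := Finset.mem_range.1 hm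
    rw [if_pos (by omega), show n + 1 - 1 - m = n - m by omega, Nat.sub_sub_self (by omega)]
  · intro m _ hm
    rw [if_neg (by simpa using hm)]

lemma derivative_truncatedSeries (N : ℕ) :
    blockSeries ^ 2 * d⁄dX ℤ (truncatedSeries N) +
        (blockSeries - 1) * d⁄dX ℤ blockSeries * truncatedSeries N + d⁄dX ℤ blockSeries =
      N.factorial * d⁄dX ℤ blockSeries * blockSeries ^ N := by
  induction N with
  | zero => simp [truncatedSeries]
  | succ N ih =>
    have hs : truncatedSeries (N + 1) =
        truncatedSeries N + (N.factorial : ℤ⟦X⟧) * blockSeries ^ N :=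
      Finset.sum_range_succ _ _
    have hd : blockSeries ^ 2 * d⁄dX ℤ ((N.factorial : ℤ⟦X⟧) * blockSeries ^ N) =
        N.factorial * N * d⁄dX ℤ blockSeries * blockSeries ^ (N + 1) := by
      rw [Derivation.leibniz, Derivation.map_natCast, Derivation.leibniz_pow]
      simp only [smul_eq_mul, nsmul_eq_mul, mul_zero, add_zero]
      rcases N with _ | N
      · simp
      · simp only [Nat.add_sub_cancel]
        ring
    rw [hs, map_add, mul_add, hd, Nat.factorial_succ]
    push_cast
    linear_combination ih

lemma truncatedSeries_equation (N : ℕ) :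
    ∃ R : ℤ⟦X⟧, (X ^ 2 - X ^ 3 - X ^ 4 + X ^ 5) * d⁄dX ℤ (truncatedSeries N) -
        (1 - 2 * X - 2 * X ^ 3 - X ^ 4) * truncatedSeries N +
        (1 - X - 3 * X ^ 2 - X ^ 3) = X ^ N * R := by
  have hw := one_add_X_mul_blockSeries
  have hd := congrArg (d⁄dX ℤ) hw
  simp only [Derivation.leibniz, map_add, map_sub, Derivation.map_one_eq_zero, derivative_X,
    smul_eq_mul] at hd
  have hd' : (1 + X) ^ 2 * d⁄dX ℤ blockSeries = 1 - 2 * X - X ^ 2 := by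
    linear_combination (1 + X) * hd - hw
  refine ⟨(1 + X) * (1 - 2 * X - X ^ 2) * (N.factorial : ℤ⟦X⟧) * delannoySeries 1 ^ N, ?_⟩
  have h := derivative_truncatedSeries N
  have hp : blockSeries ^ N = X ^ N * delannoySeries 1 ^ N := by rw [blockSeries, mul_pow]
  rw [hp] at h
  set F := truncatedSeries N
  set F' := d⁄dX ℤ F
  set w := blockSeries
  set w' := d⁄dX ℤ w
  linear_combination (1 + X) ^ 3 * h
    - (1 + X) * ((1 + X) * w + X * (1 - X)) * F' * hw
    - (1 - 2 * X - X ^ 2) * F * hw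
    - ((1 + X) * w - (1 + X)) * F * hd' - (1 + X) * hd'
    + (1 + X) * (N.factorial : ℤ⟦X⟧) * X ^ N * delannoySeries 1 ^ N * hd'

lemma A_one_recurrence (n : ℕ) :
    (A (n + 4) 1 : ℤ) = (n + 5) * A (n + 3) 1 - (n + 2) * A (n + 2) 1 - (n - 1) * A (n + 1) 1 +
      (n + 1) * A n 1 := by
  obtain ⟨R, h⟩ := truncatedSeries_equation (n + 5)
  have hc := congrArg (coeff (n + 4)) h
  have h2 : (2 : ℤ⟦X⟧) = C 2 := by simp
  have h3 : (3 : ℤ⟦X⟧) = C 3 := by simp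
  simp only [sub_mul, add_mul, one_mul, h2, h3, mul_assoc, map_add, map_sub, coeff_C_mul,
    coeff_X_pow_mul', coeff_derivative, coeff_one, coeff_X_pow, coeff_X] at hc
  have hX : coeff (n + 4) ((X : ℤ⟦X⟧) * truncatedSeries (n + 5)) = A (n + 3) 1 := by
    rw [coeff_succ_X_mul, coeff_truncatedSeries (by omega)]
  simp only [hX, show n + 4 - 2 + 1 = n + 3 by omega,
    show n + 4 - 4 = n by omega,
    show n + 4 - 3 = n + 1 by omega] at hc
  have h5 : (if 5 ≤ n + 4 then (A (n + 4 - 5 + 1) 1 : ℤ) * ((n + 4 - 5 : ℕ) + 1) else 0) =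
      A n 1 * n := by
    rcases n with _ | n <;> simp
  have hlt : ∀ {j}, j < n + 5 → coeff j (truncatedSeries (n + 5)) = A j 1 := coeff_truncatedSeries
  rw [hlt (by omega), hlt (by omega), hlt (by omega), hlt (by omega), hlt (by omega),
    hlt (by omega)] at hc
  rw [h5, if_pos (by omega), if_pos (by omega), if_pos (by omega), if_pos (by omega),
    if_pos (by omega), if_neg (by omega), if_neg (by omega), if_neg (by omega),
    if_neg (by omega), if_neg (by omega), show n + 4 - 2 = n + 2 by omega,
    show n + 1 + 1 = n + 2 by rfl] at hc
  push_cast at hc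
  linear_combination -hc

end PowerSeries

lemma delannoyCoeff_le (m k : ℕ) : delannoyCoeff m k ≤ 2 ^ k * (m + k - 1).choose k := by
  induction m generalizing k with
  | zero => rcases k with _ | k <;> simp [delannoyCoeff]
  | succ m ihm =>
    induction k with
    | zero => simp [delannoyCoeff]
    | succ k ihk =>
      have h1 := ihm (k + 1)
      have h2 := ihm k
      have h3 : (m + k - 1).choose k ≤ (m + k).choose k := Nat.choose_le_choose k (by omega)
      rw [show m + (k + 1) - 1 = m + k by omega] at h1
      rw [show m + 1 + k - 1 = m + k by omega] at ihk
      rw [delannoyCoeff_succ_succ, show m + 1 + (k + 1) - 1 = m + k + 1 by omega,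
        Nat.choose_succ_succ]
      rw [pow_succ] at *
      nlinarith [Nat.mul_le_mul_left (2 ^ k) h3]

lemma le_delannoyCoeff (m k : ℕ) : 2 ^ k * m.choose k ≤ delannoyCoeff m k := by
  induction m generalizing k with
  | zero => rcases k with _ | k <;> simp [delannoyCoeff]
  | succ m ihm =>
    induction k with
    | zero => simp [delannoyCoeff]
    | succ k ihk =>
      have h1 := ihm (k + 1)
      have h2 := ihm k
      have h3 : m.choose k ≤ (m + 1).choose k := Nat.choose_le_choose k (by omega)
      rw [delannoyCoeff_succ_succ, Nat.choose_succ_succ]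
      rw [pow_succ] at *
      nlinarith [Nat.mul_le_mul_left (2 ^ k) h3]

lemma delannoyCoeff_mul_factorial_div_le (m k : ℕ) :
    (delannoyCoeff m k : ℝ) * m.factorial / (m + k).factorial ≤ 2 ^ k / k.factorial := by
  rw [div_le_div_iff₀ (by positivity) (by positivity)]
  have h1 := delannoyCoeff_le m k
  have h2 : (m + k - 1).choose k ≤ (m + k).choose k := Nat.choose_le_choose k (by omega)
  have h3 := Nat.add_choose_mul_factorial_mul_factorial m k
  have h4 : delannoyCoeff m k ≤ 2 ^ k * (m + k).choose k := h1.trans (Nat.mul_le_mul_left _ h2)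
  have h5 : delannoyCoeff m k * m.factorial * k.factorial ≤ 2 ^ k * (m + k).factorial := by
    calc _ ≤ 2 ^ k * (m + k).choose k * m.factorial * k.factorial := by gcongr
      _ = _ := by rw [← h3]; ring
  exact_mod_cast h5

lemma tendsto_choose_mul_factorial_div (k : ℕ) :
    Tendsto (fun m : ℕ => (m.choose k : ℝ) * m.factorial / (m + k).factorial) atTop
      (nhds (1 / k.factorial)) := by
  induction k with
  | zero =>
    refine tendsto_const_nhds.congr fun m => ?_
    simp [Nat.factorial_ne_zero]
  | succ k ih =>
    have hlim : Tendsto (fun m : ℕ => 1 - (2 * k + 1) / ((m : ℝ) + (k + 1))) atTop (nhds (1 - 0)) :=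
      tendsto_const_nhds.sub (Tendsto.const_div_atTop
        (tendsto_atTop_add_const_right _ _ tendsto_natCast_atTop_atTop) _)
    have h := (ih.mul hlim).div_const ((k : ℝ) + 1)
    rw [show (1 : ℝ) / k.factorial * (1 - 0) / (k + 1) = 1 / (k + 1).factorial by
      rw [Nat.factorial_succ]
      push_cast
      field_simp
      ring] at h
    refine h.congr fun m => ?_
    have hchoose : (m.choose (k + 1) : ℝ) = m.choose k * (m - k) / (k + 1) := by
      rw [eq_div_iff (by positivity)]
      rcases le_total k m with hkm | hkm
      · rw [← Nat.cast_sub hkm]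
        exact_mod_cast Nat.choose_succ_right_eq m k
      · rcases hkm.eq_or_lt with rfl | hkm
        · simp
        · simp [Nat.choose_eq_zero_of_lt hkm, Nat.choose_eq_zero_of_lt (hkm.trans k.lt_succ_self)]
    rw [hchoose, ← add_assoc, ← add_assoc, Nat.factorial_succ (m + k)]
    push_cast
    field_simp
    ring

lemma tendsto_delannoyCoeff_mul_factorial_div (k : ℕ) :
    Tendsto (fun m : ℕ => (delannoyCoeff m k : ℝ) * m.factorial / (m + k).factorial) atTop
      (nhds (2 ^ k / k.factorial)) := by
  refine tendsto_of_tendsto_of_tendsto_of_le_of_le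
    (g := fun m : ℕ => 2 ^ k * ((m.choose k : ℝ) * m.factorial / (m + k).factorial)) ?_
    tendsto_const_nhds (fun m => ?_) fun m => delannoyCoeff_mul_factorial_div_le m k
  · simpa [div_eq_mul_inv] using (tendsto_choose_mul_factorial_div k).const_mul (2 ^ k)
  · have h : (2 : ℝ) ^ k * m.choose k ≤ delannoyCoeff m k := by exact_mod_cast le_delannoyCoeff m k
    simp only
    rw [← mul_div_assoc, ← mul_assoc]
    gcongr

lemma tendsto_A_one_div_factorial :
    Tendsto (fun n : ℕ => (A n 1 : ℝ) / n.factorial) atTop (nhds (Real.exp (-2))) := by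
  have hA : ∀ n : ℕ, (A n 1 : ℝ) = ∑ k ∈ Finset.range (n + 1),
      (-1) ^ k * (delannoyCoeff (n - k) k : ℝ) * (n - k).factorial := fun n => by
    exact_mod_cast congrArg (Int.cast (R := ℝ)) (A_one_eq_sum n)
  set f : ℕ → ℕ → ℝ := fun n k => if k ≤ n then
    (-1) ^ k * ((delannoyCoeff (n - k) k : ℝ) * (n - k).factorial / n.factorial) else 0 with hf
  have hsum : ∀ n : ℕ, ∑' k, f n k = (A n 1 : ℝ) / n.factorial := fun n => by
    rw [tsum_eq_sum (s := Finset.range (n + 1)), hA, Finset.sum_div]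
    · refine Finset.sum_congr rfl fun k hk => ?_
      simp only [hf]
      rw [if_pos (Nat.lt_succ_iff.1 (Finset.mem_range.1 hk))]
      ring
    · intro k hk
      exact if_neg fun h => hk (Finset.mem_range.2 (Nat.lt_succ_of_le h))
  have hexp : ∑' k : ℕ, (-2 : ℝ) ^ k / k.factorial = Real.exp (-2) := by
    rw [Real.exp_eq_exp_ℝ, NormedSpace.exp_eq_tsum_div]
  simp_rw [← hsum, ← hexp]
  refine tendsto_tsum_of_dominated_convergence (bound := fun k : ℕ => (2 : ℝ) ^ k / k.factorial)
    (Real.summable_pow_div_factorial 2) (fun k => ?_) (Eventually.of_forall fun n k => ?_)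
  · rw [← tendsto_add_atTop_iff_nat k]
    have h := (tendsto_delannoyCoeff_mul_factorial_div k).const_mul ((-1) ^ k)
    rw [← mul_div_assoc, ← mul_pow, neg_one_mul] at h
    refine h.congr fun m => ?_
    simp [hf]
  · simp only [hf]
    split_ifs with h
    · obtain ⟨m, rfl⟩ := Nat.exists_eq_add_of_le' h
      rw [norm_mul, norm_pow, norm_neg, norm_one, one_pow, one_mul, Nat.add_sub_cancel,
        Real.norm_of_nonneg (by positivity)]
      exact delannoyCoeff_mul_factorial_div_le m k
    · rw [norm_zero]
      positivity

lemma abs_le_of_abs_sub_div_mul_le {x a y z L M : ℝ} {s q : ℕ} (hx : 0 < x) (ha : x ≤ a)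
    (hz : |z| ≤ L / x ^ s) (h : |y - 1 / a * z| ≤ M / x ^ q) :
    |y| ≤ L / x ^ (s + 1) + M / x ^ q := by
  have h1 : |1 / a * z| ≤ L / x ^ (s + 1) := by
    rw [abs_mul, abs_of_nonneg (by have := hx.trans_le ha; positivity)]
    refine (mul_le_mul (one_div_le_one_div_of_le hx ha) hz (abs_nonneg _)
      (by positivity)).trans_eq ?_
    rw [pow_succ]
    field_simp
  have h2 := abs_add_le (1 / a * z) (y - 1 / a * z)
  rw [add_sub_cancel] at h2
  linarith

lemma abs_le_of_abs_sub_le {e : ℕ → ℝ} (he : Tendsto e atTop (nhds 0)) {K : ℝ} (hK : 0 ≤ K)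
    {q : ℕ} (hq : q ≠ 0)
    (h : ∀ n : ℕ, |e (n + 1) - e n| ≤ K / ((n : ℝ) + 1) ^ (q + 1)) (n : ℕ) :
    |e n| ≤ 2 * K / ((n : ℝ) + 1) ^ q := by
  set t : ℕ → ℝ := fun n => 2 * K / ((n : ℝ) + 1) ^ q with ht
  have ht0 : Tendsto t atTop (nhds 0) := by
    refine Tendsto.const_div_atTop ((tendsto_pow_atTop hq).comp ?_) _
    exact tendsto_atTop_add_const_right _ _ tendsto_natCast_atTop_atTop
  have hstep : ∀ n : ℕ, K / ((n : ℝ) + 1) ^ (q + 1) ≤ t n - t (n + 1) := by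
    intro n
    obtain ⟨p, rfl⟩ : ∃ p, q = p + 1 := ⟨q - 1, by omega⟩
    have hx : (1 : ℝ) ≤ (n : ℝ) + 1 := by simp
    simp only [ht]
    push_cast
    generalize (n : ℝ) + 1 = x at hx
    have hx0 : 0 < x := by linarith
    have h1 : 2 * K / (x + 1) ^ (p + 1) ≤ 2 * K / (x ^ p * (x + 1)) := by
      rw [pow_succ]
      gcongr
      linarith
    have h2 : 2 * K / x ^ (p + 1) - 2 * K / (x ^ p * (x + 1)) - K / x ^ (p + 1 + 1) =
        K * (x - 1) / (x ^ (p + 2) * (x + 1)) := by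
      field_simp
      ring
    have h3 : 0 ≤ K * (x - 1) / (x ^ (p + 2) * (x + 1)) := by
      have : 0 ≤ x - 1 := by linarith
      positivity
    linarith
  rw [abs_le]
  constructor
  · have hanti : Antitone fun n => e n + t n := antitone_nat_of_succ_le fun n => by
      have := (abs_le.1 (h n)).2
      linarith [hstep n]
    have := hanti.le_of_tendsto (a := 0) (by simpa using he.add ht0) n
    simp only [ht] at this
    linarith
  · have hmono : Monotone fun n => e n - t n := monotone_nat_of_le_succ fun n => by
      have := (abs_le.1 (h n)).1
      linarith [hstep n]
    have := hmono.ge_of_tendsto (a := 0) (by simpa using he.sub ht0) n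
    simp only [ht] at this
    linarith

/-- The polynomial decay satisfied by small solutions of a perturbed recurrence can be improved
up to the order of the perturbation. -/
lemma exists_abs_le_of_recurrence {e ρ : ℕ → ℝ} (he : Tendsto e atTop (nhds 0)) {C : ℝ} {r : ℕ}
    (hρ : ∀ n : ℕ, |ρ n| ≤ C / ((n : ℝ) + 1) ^ (r + 1))
    (h : ∀ n : ℕ, e (n + 4) = (n + 5) / (n + 4) * e (n + 3)
      - (n + 2) / ((n + 4) * (n + 3)) * e (n + 2)
      - (n - 1) / ((n + 4) * (n + 3) * (n + 2)) * e (n + 1)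
      + 1 / ((n + 4) * (n + 3) * (n + 2)) * e n + ρ n) {p : ℕ} (hp : p ≤ r) :
    ∃ K : ℝ, ∀ n : ℕ, |e n| ≤ K / ((n : ℝ) + 1) ^ p := by
  induction p with
  | zero =>
    obtain ⟨K, hK⟩ := he.abs.bddAbove_range
    exact ⟨K, fun n => by simpa using hK (Set.mem_range_self n)⟩
  | succ p ih =>
    obtain ⟨K, hK⟩ := ih (by omega)
    have hK0 : 0 ≤ K := by
      have := (abs_nonneg _).trans (hK 0)
      simpa using this
    have hC0 : 0 ≤ C := by
      have := (abs_nonneg _).trans (hρ 0)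
      simpa using this
    have hshift : ∀ n j : ℕ, |e (n + j)| ≤ K / ((n : ℝ) + 1) ^ p := fun n j => by
      refine (hK (n + j)).trans ?_
      push_cast
      gcongr
      simp
    have hdiff : ∀ n : ℕ, e (n + 4) - e (n + 3) = 1 / (n + 4) * (e (n + 3) - e (n + 2))
        + 1 / ((n + 4) * (n + 3)) * e (n + 2)
        - (n - 1) / ((n + 4) * (n + 3) * (n + 2)) * e (n + 1)
        + 1 / ((n + 4) * (n + 3) * (n + 2)) * e n + ρ n := fun n => by
      rw [h n]
      field_simp
      ring
    have hx : ∀ n : ℕ, (0 : ℝ) < (n : ℝ) + 1 := fun n => by positivity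
    have hterm : ∀ (n j : ℕ) (c : ℝ), |c| ≤ 1 / ((n : ℝ) + 1) ^ 2 →
        |c * e (n + j)| ≤ K / ((n : ℝ) + 1) ^ (p + 2) := fun n j c hc => by
      rw [abs_mul]
      refine (mul_le_mul hc (hshift n j) (abs_nonneg _) (by positivity)).trans_eq ?_
      rw [pow_add]
      field_simp
    obtain ⟨M, hM⟩ : ∃ M, M = 3 * K + C := ⟨_, rfl⟩
    have hrest : ∀ n : ℕ, |e (n + 4) - e (n + 3) - 1 / (n + 4) * (e (n + 3) - e (n + 2))| ≤
        M / ((n : ℝ) + 1) ^ (p + 2) := fun n => by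
      have hn : (0 : ℝ) ≤ n := n.cast_nonneg
      have h2 := hterm n 2 (1 / ((n + 4) * (n + 3))) (by
        rw [abs_of_nonneg (by positivity)]
        gcongr
        nlinarith)
      have h1 := hterm n 1 ((n - 1) / ((n + 4) * (n + 3) * (n + 2))) (by
        rw [abs_div, abs_of_nonneg (by positivity : (0 : ℝ) ≤ (n + 4) * (n + 3) * (n + 2)),
          div_le_div_iff₀ (by positivity) (by positivity)]
        have : |(n : ℝ) - 1| ≤ n + 1 := abs_le.2 ⟨by linarith, by linarith⟩
        have h3 : |(n : ℝ) - 1| * ((n : ℝ) + 1) ^ 2 ≤ (n + 1) * ((n : ℝ) + 1) ^ 2 := by gcongr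
        nlinarith [mul_nonneg hn hn])
      have h0 := hterm n 0 (1 / ((n + 4) * (n + 3) * (n + 2))) (by
        rw [abs_of_nonneg (by positivity)]
        gcongr
        nlinarith [mul_nonneg hn hn, mul_nonneg (mul_nonneg hn hn) hn])
      have hρ' : |ρ n| ≤ C / ((n : ℝ) + 1) ^ (p + 2) := by
        exact (hρ n).trans (div_le_div_of_nonneg_left hC0 (by positivity)
          (pow_le_pow_right₀ (by linarith) (by omega)))
      have hsum : M / ((n : ℝ) + 1) ^ (p + 2) = K / ((n : ℝ) + 1) ^ (p + 2)
          + K / ((n : ℝ) + 1) ^ (p + 2) + K / ((n : ℝ) + 1) ^ (p + 2)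
          + C / ((n : ℝ) + 1) ^ (p + 2) := by
        rw [hM]
        ring
      rw [hdiff, hsum]
      rw [abs_le] at *
      rw [add_zero] at h0
      constructor <;> linarith [h0.1, h0.2, h1.1, h1.2, h2.1, h2.2, hρ'.1, hρ'.2]
    have hM0 : 0 ≤ M := by rw [hM]; positivity
    have hfirst : ∀ n : ℕ, |e (n + 4) - e (n + 3)| ≤ (2 * K + M) / ((n : ℝ) + 1) ^ (p + 1) := by
      intro n
      refine (abs_le_of_abs_sub_div_mul_le (L := 2 * K) (s := p) (hx n) (by linarith) ?_
        (hrest n)).trans ?_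
      · have := abs_sub (e (n + 3)) (e (n + 2))
        rw [two_mul, add_div]
        linarith [hshift n 3, hshift n 2]
      · rw [add_div]
        refine add_le_add_right ?_ _
        exact div_le_div_of_nonneg_left hM0 (pow_pos (hx n) _)
          (pow_le_pow_right₀ (by simp) (by omega))
    have hsecond : ∀ n : ℕ, |e (n + 1 + 4) - e (n + 4)| ≤
        (2 * K + 2 * M) / ((n : ℝ) + 1) ^ (p + 2) := by
      intro n
      refine (abs_le_of_abs_sub_div_mul_le (a := (n + 1 : ℕ) + 4) (M := M) (q := p + 2) (hx n)
        (by push_cast; linarith) (hfirst n) ((hrest (n + 1)).trans ?_)).trans_eq ?_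
      · push_cast
        gcongr
        simp
      rw [← add_div]
      congr 1
      ring
    have hfinal := abs_le_of_abs_sub_le (q := p + 1) (e := fun n => e (n + 4))
      ((tendsto_add_atTop_iff_nat 4).2 he) (by positivity) (Nat.succ_ne_zero p : p + 1 ≠ 0) hsecond
    set L := 2 * (2 * K + 2 * M) with hL
    refine ⟨(K + L) * 5 ^ (p + 1), fun n => ?_⟩
    have hL0 : 0 ≤ L := by positivity
    rcases lt_or_ge n 4 with hn | hn
    · have h1 : |e n| ≤ K := by
        refine (hK n).trans (div_le_self hK0 (one_le_pow₀ (by simp)))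
      refine h1.trans ?_
      rw [le_div_iff₀ (by positivity)]
      have h2 : ((n : ℝ) + 1) ^ (p + 1) ≤ 5 ^ (p + 1) := by
        gcongr
        have : (n : ℝ) < 4 := by exact_mod_cast hn
        linarith
      nlinarith [pow_pos (hx n) (p + 1)]
    · obtain ⟨m, rfl⟩ := Nat.exists_eq_add_of_le' hn
      refine (hfinal m).trans ?_
      rw [div_le_div_iff₀ (by positivity) (by positivity)]
      have h2 : (((m + 4 : ℕ) : ℝ) + 1) ^ (p + 1) ≤ 5 ^ (p + 1) * ((m : ℝ) + 1) ^ (p + 1) := by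
        rw [← mul_pow]
        gcongr
        push_cast
        nlinarith [(m.cast_nonneg : (0 : ℝ) ≤ m)]
      calc L * (((m + 4 : ℕ) : ℝ) + 1) ^ (p + 1)
          ≤ (K + L) * (5 ^ (p + 1) * ((m : ℝ) + 1) ^ (p + 1)) := by
            gcongr
            linarith
        _ = _ := by ring

lemma A_one_div_factorial_recurrence (n : ℕ) :
    (A (n + 4) 1 : ℝ) / (n + 4).factorial =
      (n + 5) / (n + 4) * ((A (n + 3) 1 : ℝ) / (n + 3).factorial)
      - (n + 2) / ((n + 4) * (n + 3)) * ((A (n + 2) 1 : ℝ) / (n + 2).factorial)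
      - (n - 1) / ((n + 4) * (n + 3) * (n + 2)) * ((A (n + 1) 1 : ℝ) / (n + 1).factorial)
      + 1 / ((n + 4) * (n + 3) * (n + 2)) * ((A n 1 : ℝ) / n.factorial) := by
  have h : (A (n + 4) 1 : ℝ) = (n + 5) * A (n + 3) 1 - (n + 2) * A (n + 2) 1
      - (n - 1) * A (n + 1) 1 + (n + 1) * A n 1 := by
    exact_mod_cast congrArg (Int.cast (R := ℝ)) (A_one_recurrence n)
  rw [h, Nat.factorial_succ (n + 3), Nat.factorial_succ (n + 2), Nat.factorial_succ (n + 1),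
    Nat.factorial_succ n]
  push_cast
  field_simp
  ring

/-- The expansion `1 - 2/n² - 10/(3n³) - 6/n⁴ - 154/(15n⁵)` rewritten in inverse rising factorials,
which removes the pole at `0`. -/
noncomputable def inverseFactorialExpansion (x : ℝ) : ℝ :=
  1 - 2 / ((x + 1) * (x + 2)) - 28 / (3 * ((x + 1) * (x + 2) * (x + 3)))
    - 48 / ((x + 1) * (x + 2) * (x + 3) * (x + 4))
    - 4304 / (15 * ((x + 1) * (x + 2) * (x + 3) * (x + 4) * (x + 5)))

lemma inverseFactorialExpansion_residual {x : ℝ} (hx : 0 ≤ x) :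
    inverseFactorialExpansion (x + 4) - ((x + 5) / (x + 4) * inverseFactorialExpansion (x + 3)
      - (x + 2) / ((x + 4) * (x + 3)) * inverseFactorialExpansion (x + 2)
      - (x - 1) / ((x + 4) * (x + 3) * (x + 2)) * inverseFactorialExpansion (x + 1)
      + 1 / ((x + 4) * (x + 3) * (x + 2)) * inverseFactorialExpansion x) =
    (12175488 / 5 + 2677480 / 3 * x - 3053716 / 3 * x ^ 2 - 2073956 / 3 * x ^ 3
      - 2316604 / 15 * x ^ 4 - 35492 / 3 * x ^ 5) /
    ((x + 1) * (x + 2) ^ 2 * (x + 3) ^ 2 * (x + 4) ^ 2 * (x + 5) * (x + 6) * (x + 7) * (x + 8)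
      * (x + 9)) := by
  simp only [inverseFactorialExpansion, add_assoc]
  norm_num only
  field_simp
  ring

lemma abs_inverseFactorialExpansion_residual_le {x : ℝ} (hx : 0 ≤ x) :
    |inverseFactorialExpansion (x + 4) - ((x + 5) / (x + 4) * inverseFactorialExpansion (x + 3)
      - (x + 2) / ((x + 4) * (x + 3)) * inverseFactorialExpansion (x + 2)
      - (x - 1) / ((x + 4) * (x + 3) * (x + 2)) * inverseFactorialExpansion (x + 1)
      + 1 / ((x + 4) * (x + 3) * (x + 2)) * inverseFactorialExpansion x)| ≤
    3000000 / (x + 1) ^ 7 := by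
  rw [inverseFactorialExpansion_residual hx, abs_div,
    abs_of_nonneg (a := (x + 1) * (x + 2) ^ 2 * (x + 3) ^ 2 * _ * _ * _ * _ * _ * _)
      (by positivity)]
  have hN : |12175488 / 5 + 2677480 / 3 * x - 3053716 / 3 * x ^ 2 - 2073956 / 3 * x ^ 3
      - 2316604 / 15 * x ^ 4 - 35492 / 3 * x ^ 5| ≤ 3000000 * (x + 1) ^ 5 := by
    have h2 := pow_nonneg hx 2
    have h3 := pow_nonneg hx 3
    have h4 := pow_nonneg hx 4
    have h5 := pow_nonneg hx 5
    rw [abs_le]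
    constructor <;> linarith
  calc _ ≤ 3000000 * (x + 1) ^ 5 / ((x + 1) * (x + 1) ^ 2 * (x + 1) ^ 2 * (x + 1) ^ 2 * (x + 1)
        * (x + 1) * (x + 1) * (x + 1) * (x + 1)) := by
        gcongr <;> norm_num
    _ = _ := by field_simp

lemma abs_inverseFactorialExpansion_sub_le {x : ℝ} (hx : 0 < x) :
    |inverseFactorialExpansion x - (1 - 2 / x ^ 2 - 10 / (3 * x ^ 3) - 6 / x ^ 4
      - 154 / (15 * x ^ 5))| ≤ 5000 / x ^ 6 := by
  have h : inverseFactorialExpansion x - (1 - 2 / x ^ 2 - 10 / (3 * x ^ 3) - 6 / x ^ 4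
      - 154 / (15 * x ^ 5)) = (1232 + 52996 / 15 * x + 4354 * x ^ 2 + 3376 * x ^ 3
      + 1962 * x ^ 4) / (x ^ 5 * ((x + 1) * (x + 2) * (x + 3) * (x + 4) * (x + 5))) := by
    rw [inverseFactorialExpansion]
    field_simp
    ring
  rw [h, abs_of_nonneg (by positivity), div_le_div_iff₀ (by positivity) (by positivity)]
  have h1 : (1232 + 52996 / 15 * x + 4354 * x ^ 2 + 3376 * x ^ 3 + 1962 * x ^ 4) * x ≤
      5000 * ((x + 1) * (x + 2) * (x + 3) * (x + 4) * (x + 5)) := by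
    have h2 := pow_pos hx 2
    have h3 := pow_pos hx 3
    have h4 := pow_pos hx 4
    have h5 := pow_pos hx 5
    linarith
  calc _ = (1232 + 52996 / 15 * x + 4354 * x ^ 2 + 3376 * x ^ 3 + 1962 * x ^ 4) * x * x ^ 5 := by
        ring
    _ ≤ _ := mul_le_mul_of_nonneg_right h1 (by positivity)
    _ = _ := by ring

lemma tendsto_inverseFactorialExpansion :
    Tendsto (fun n : ℕ => inverseFactorialExpansion n) atTop (nhds 1) := by
  have hlin : ∀ c : ℝ, Tendsto (fun n : ℕ => (n : ℝ) + c) atTop atTop := fun c =>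
    tendsto_atTop_add_const_right _ _ tendsto_natCast_atTop_atTop
  have h2 := (hlin 1).atTop_mul_atTop₀ (hlin 2)
  have h3 := h2.atTop_mul_atTop₀ (hlin 3)
  have h4 := h3.atTop_mul_atTop₀ (hlin 4)
  have h5 := h4.atTop_mul_atTop₀ (hlin 5)
  have h := (((h2.const_div_atTop 2).const_sub 1).sub
    ((h3.const_mul_atTop three_pos).const_div_atTop 28)).sub (h4.const_div_atTop 48) |>.sub
    ((h5.const_mul_atTop (by norm_num : (0 : ℝ) < 15)).const_div_atTop 4304)
  simpa [inverseFactorialExpansion] using h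

/-- `a_{n,1}/n! = e^{−2}(1 − 2/n² − 10/(3n³) − 6/n⁴ − 154/(15n⁵)) + O(1/n⁶)`. -/
theorem a_n1_asymptotics :
    (fun n : ℕ => (A n 1 : ℝ) / (Nat.factorial n : ℝ) -
        Real.exp (-2) * (1 - 2 / (n : ℝ) ^ 2 - 10 / (3 * (n : ℝ) ^ 3) - 6 / (n : ℝ) ^ 4 -
          154 / (15 * (n : ℝ) ^ 5))) =O[atTop]
      (fun n : ℕ => 1 / (n : ℝ) ^ 6) := by
  generalize hc : Real.exp (-2) = c
  have hc0 : 0 ≤ c := hc ▸ (Real.exp_pos _).le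
  set e : ℕ → ℝ := fun n => (A n 1 : ℝ) / n.factorial - c * inverseFactorialExpansion n with he
  have he0 : Tendsto e atTop (nhds 0) := by
    simpa [hc] using tendsto_A_one_div_factorial.sub (tendsto_inverseFactorialExpansion.const_mul c)
  obtain ⟨K, hK⟩ := exists_abs_le_of_recurrence (r := 6) (C := c * 3000000) he0
    (ρ := fun n => -(c * (inverseFactorialExpansion ((n : ℝ) + 4)
      - (((n : ℝ) + 5) / (n + 4) * inverseFactorialExpansion ((n : ℝ) + 3)
      - (n + 2) / ((n + 4) * (n + 3)) * inverseFactorialExpansion ((n : ℝ) + 2)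
      - (n - 1) / ((n + 4) * (n + 3) * (n + 2)) * inverseFactorialExpansion ((n : ℝ) + 1)
      + 1 / ((n + 4) * (n + 3) * (n + 2)) * inverseFactorialExpansion n))))
    (fun n => by
      rw [abs_neg, abs_mul, abs_of_nonneg hc0, mul_div_assoc]
      exact mul_le_mul_of_nonneg_left
        (abs_inverseFactorialExpansion_residual_le n.cast_nonneg) hc0)
    (fun n => by
      simp only [he]
      rw [A_one_div_factorial_recurrence]
      push_cast
      ring) le_rfl
  refine IsBigO.of_bound (K + c * 5000) ?_
  filter_upwards [eventually_ge_atTop 1] with n hn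
  have hn0 : (0 : ℝ) < n := by exact_mod_cast hn
  have hK0 : 0 ≤ K := by
    have := (abs_nonneg _).trans (hK 0)
    simpa using this
  have h1 : |e n| ≤ K / (n : ℝ) ^ 6 := (hK n).trans (by gcongr; linarith)
  have h2 := mul_le_mul_of_nonneg_left (abs_inverseFactorialExpansion_sub_le hn0) hc0
  rw [← abs_of_nonneg hc0, ← abs_mul, abs_of_nonneg hc0] at h2
  have h3 := (abs_add_le _ _).trans (add_le_add h1 h2)
  rw [Real.norm_eq_abs, Real.norm_of_nonneg (by positivity)]
  refine (congrArg _ ?_).trans_le (h3.trans_eq ?_)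
  · simp only [he]
    ring
  · ring
end

section
/- For every integer n ≥ 1, a_{n,1} = Σ_{r=0}^{n−1} Σ_{c=0}^{r} (−1)^r 2^c (n−r)! C(r−1, c−1) C(n−r, c), with the convention that C(k, −1) = 0 for every integer k ≠ −1 and C(−1, −1) = 1 (so the term r = c = 0 contributes n!). -/
/-- `C(r−1, c−1)` for naturals `r, c`, with the convention `C(k, −1) = 0` for `k ≠ −1`
and `C(−1, −1) = 1`; i.e. for `c = 0` the value is `1` if `r = 0` and `0` otherwise. -/
def chooseShift (r c : ℕ) : ℕ :=
  if c = 0 then (if r = 0 then 1 else 0) else Nat.choose (r - 1) (c - 1)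

/-- Repetition-free lists of length `m` with entries below `N`. -/
def seqs : ℕ → ℕ → Finset (List ℕ)
  | 0, _ => {[]}
  | m + 1, N => ((Finset.range N ×ˢ seqs m N).image fun p => p.1 :: p.2).filter List.Nodup

lemma mem_seqs {m N : ℕ} {l : List ℕ} :
    l ∈ seqs m N ↔ l.length = m ∧ l.Nodup ∧ ∀ x ∈ l, x < N := by
  induction m generalizing l with
  | zero => cases l <;> simp [seqs]
  | succ m ih =>
    cases l with
    | nil => simp [seqs]
    | cons a t => simp [seqs, ih]; tauto

/-- No two consecutive entries differ by exactly one. -/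
def Spread (l : List ℕ) : Prop := l.IsChain fun x y => x + 1 ≠ y ∧ y + 1 ≠ x

/-- The second entry is one more than the first. -/
def StartsUp (l : List ℕ) : Prop := ∃ a t, l = a :: (a + 1) :: t

/-- The second entry is one less than the first. -/
def StartsDown (l : List ℕ) : Prop := ∃ a t, l = (a + 1) :: a :: t

lemma startsUp_cons_cons {a b : ℕ} {t : List ℕ} : StartsUp (a :: b :: t) ↔ b = a + 1 := by
  simp [StartsUp]

lemma startsDown_cons_cons {a b : ℕ} {t : List ℕ} : StartsDown (a :: b :: t) ↔ a = b + 1 := by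
  simp [StartsDown]

lemma spread_iff_tail {l : List ℕ} :
    Spread l ↔ Spread l.tail ∧ ¬ StartsUp l ∧ ¬ StartsDown l := by
  rcases l with _ | ⟨a, _ | ⟨b, t⟩⟩
  · simp [Spread, StartsUp, StartsDown]
  · simp [Spread, StartsUp, StartsDown]
  · rw [startsUp_cons_cons, startsDown_cons_cons]
    simp only [Spread, List.isChain_cons_cons, List.tail_cons]
    grind

open Classical in
/-- Members of `seqs m N` without consecutive entries differing by one. -/
noncomputable def spreadSeqs (m N : ℕ) : Finset (List ℕ) := (seqs m N).filter Spread

open Classical in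
/-- Members of `seqs (m + 1) N` whose tail has no consecutive entries differing by one. -/
noncomputable def tailSpreadSeqs (m N : ℕ) : Finset (List ℕ) :=
  (seqs (m + 1) N).filter fun l => Spread l.tail

open Classical in
/-- Members of `tailSpreadSeqs m N` whose second entry is one more than the first. -/
noncomputable def upSeqs (m N : ℕ) : Finset (List ℕ) := (tailSpreadSeqs m N).filter StartsUp

open Classical in
/-- Members of `tailSpreadSeqs m N` whose second entry is one less than the first. -/
noncomputable def downSeqs (m N : ℕ) : Finset (List ℕ) := (tailSpreadSeqs m N).filter StartsDown

lemma card_tailSpreadSeqs (m N : ℕ) :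
    (tailSpreadSeqs m N).card = (N - m) * (spreadSeqs m N).card := by
  have h : (tailSpreadSeqs m N).card =
      ((spreadSeqs m N).sigma fun t => Finset.range N \ t.toFinset).card := by
    refine Finset.card_nbij' (fun l => ⟨l.tail, l.headD 0⟩) (fun p => p.2 :: p.1) ?_ ?_ ?_ ?_
    · rintro (_ | ⟨a, t⟩) hl <;> simp_all [tailSpreadSeqs, spreadSeqs, mem_seqs]
    · rintro ⟨t, a⟩ hl
      simp_all [tailSpreadSeqs, spreadSeqs, mem_seqs]
    · rintro (_ | ⟨a, t⟩) hl <;> simp_all [tailSpreadSeqs, mem_seqs]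
    · rintro ⟨t, a⟩ hl
      simp
  rw [h, Finset.card_sigma, Finset.sum_const_nat (m := N - m), mul_comm]
  intro t ht
  simp only [spreadSeqs, Finset.mem_filter, mem_seqs] at ht
  obtain ⟨⟨rfl, hn, hlt⟩, -⟩ := ht
  rw [Finset.card_sdiff_of_subset (fun x hx => by simpa using hlt x (by simpa using hx)),
    Finset.card_range, List.toFinset_card_of_nodup hn]

lemma card_tailSpreadSeqs_eq_add (m N : ℕ) :
    (tailSpreadSeqs m N).card =
      (spreadSeqs (m + 1) N).card + (upSeqs m N).card + (downSeqs m N).card := by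
  classical
  have h : tailSpreadSeqs m N = spreadSeqs (m + 1) N ∪ upSeqs m N ∪ downSeqs m N := by
    ext l
    have := @spread_iff_tail l
    simp only [tailSpreadSeqs, spreadSeqs, upSeqs, downSeqs, Finset.mem_union, Finset.mem_filter]
    tauto
  rw [h, Finset.card_union_of_disjoint, Finset.card_union_of_disjoint]
  · refine Finset.disjoint_left.2 fun l hl hl' => ?_
    have := @spread_iff_tail l
    simp only [spreadSeqs, upSeqs, Finset.mem_filter] at hl hl'
    tauto
  · refine Finset.disjoint_left.2 fun l hl hl' => ?_
    have := @spread_iff_tail l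
    simp only [spreadSeqs, upSeqs, downSeqs, Finset.mem_union, Finset.mem_filter] at hl hl'
    obtain ⟨-, a, t, rfl⟩ := hl'
    simp only [startsUp_cons_cons, startsDown_cons_cons] at *
    grind

lemma Spread.map {l : List ℕ} {f : ℕ → ℕ} (hl : Spread l)
    (hf : ∀ x ∈ l, ∀ y ∈ l, x + 1 ≠ y ∧ y + 1 ≠ x → f x + 1 ≠ f y ∧ f y + 1 ≠ f x) :
    Spread (l.map f) :=
  (List.isChain_map f).2 (hl.imp_of_mem_imp fun x y hx hy h => hf x hx y hy h)

lemma map_mem_seqs {m N N' : ℕ} {l : List ℕ} {f : ℕ → ℕ} (hl : l ∈ seqs m N)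
    (hinj : ∀ x ∈ l, ∀ y ∈ l, f x = f y → x = y) (hlt : ∀ x ∈ l, f x < N') :
    l.map f ∈ seqs m N' := by
  rw [mem_seqs] at hl ⊢
  refine ⟨by simpa using hl.1, List.Nodup.map_on hinj hl.2.1, by simpa using hlt⟩

lemma card_downSeqs (m N : ℕ) : (downSeqs m N).card = (upSeqs m N).card := by
  have hmem : ∀ l ∈ tailSpreadSeqs m N, l.map (N - 1 - ·) ∈ tailSpreadSeqs m N := by
    intro l hl
    simp only [tailSpreadSeqs, Finset.mem_filter] at hl ⊢
    have hlt := (mem_seqs.1 hl.1).2.2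
    refine ⟨map_mem_seqs hl.1 ?_ ?_, ?_⟩
    · intro x hx y hy
      have := hlt x hx
      have := hlt y hy
      omega
    · intro x hx
      have := hlt x hx
      omega
    · rw [← List.map_tail]
      refine hl.2.map fun x hx y hy h => ?_
      have := hlt x (List.mem_of_mem_tail hx)
      have := hlt y (List.mem_of_mem_tail hy)
      omega
  have hinv : ∀ l ∈ tailSpreadSeqs m N, (l.map (N - 1 - ·)).map (N - 1 - ·) = l := by
    intro l hl
    simp only [tailSpreadSeqs, Finset.mem_filter, mem_seqs] at hl
    rw [List.map_map]
    refine (List.map_congr_left fun x hx => ?_).trans (List.map_id _)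
    have := hl.1.2.2 x hx
    simp only [Function.comp_apply, id_eq]
    omega
  have hlt : ∀ a b t, a :: b :: t ∈ tailSpreadSeqs m N → a < N ∧ b < N := by
    intro a b t h
    simp only [tailSpreadSeqs, Finset.mem_filter, mem_seqs] at h
    exact ⟨h.1.2.2 a (by simp), h.1.2.2 b (by simp)⟩
  refine Finset.card_nbij' (List.map (N - 1 - ·)) (List.map (N - 1 - ·)) ?_ ?_ ?_ ?_
  · intro l hl
    simp only [downSeqs, upSeqs, Finset.mem_coe, Finset.mem_filter] at hl ⊢
    refine ⟨hmem l hl.1, ?_⟩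
    obtain ⟨hl, a, t, rfl⟩ := hl
    have := hlt _ _ _ hl
    simp only [List.map_cons, startsUp_cons_cons]
    omega
  · intro l hl
    simp only [downSeqs, upSeqs, Finset.mem_coe, Finset.mem_filter] at hl ⊢
    refine ⟨hmem l hl.1, ?_⟩
    obtain ⟨hl, a, t, rfl⟩ := hl
    have := hlt _ _ _ hl
    simp only [List.map_cons, startsDown_cons_cons]
    omega
  · intro l hl
    simp only [downSeqs, Finset.mem_coe, Finset.mem_filter] at hl
    exact hinv l hl.1
  · intro l hl
    simp only [upSeqs, Finset.mem_coe, Finset.mem_filter] at hl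
    exact hinv l hl.1

/-- The order isomorphism closing the gap left by the value `v`. -/
def lower (v x : ℕ) : ℕ := if x < v then x else x - 1

/-- The inverse of `lower v`, making room for the value `v`. -/
def raise (v x : ℕ) : ℕ := if x < v then x else x + 1

lemma lower_raise (v x : ℕ) : lower v (raise v x) = x := by
  grind [lower, raise]

lemma raise_lower {v x : ℕ} (h : x ≠ v) : raise v (lower v x) = x := by
  grind [lower, raise]

lemma card_upSeqs_add (m N : ℕ) :
    (upSeqs (m + 1) (N + 1)).card + (upSeqs m N).card = (tailSpreadSeqs m N).card := by
  classical
  have h : (tailSpreadSeqs m N).card =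
      (upSeqs m N).card + ((tailSpreadSeqs m N).filter fun g => ¬ StartsUp g).card := by
    rw [upSeqs]
    convert (Finset.card_filter_add_card_filter_not (s := tailSpreadSeqs m N) StartsUp).symm
  rw [h, add_comm, add_right_inj]
  refine Finset.card_nbij' (fun l => l.tail.map (lower (l.headD 0)))
    (fun g => g.headD 0 :: g.map (raise (g.headD 0))) ?_ ?_ ?_ ?_
  · intro l hl
    simp only [upSeqs, tailSpreadSeqs, Finset.mem_coe, Finset.mem_filter] at hl ⊢
    obtain ⟨⟨hl, hs⟩, v, t, rfl⟩ := hl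
    rw [mem_seqs] at hl
    obtain ⟨hlen, hnd, hlt⟩ := hl
    rw [List.nodup_cons] at hnd
    have hv : ∀ x ∈ (v + 1) :: t, x ≠ v := fun x hx hxv => hnd.1 (hxv ▸ hx)
    have hv' : ∀ x ∈ t, x ≠ v + 1 := fun x hx hxv => (List.nodup_cons.1 hnd.2).1 (hxv ▸ hx)
    have hvN : v < N := by simpa using hlt (v + 1) (by simp)
    have htail : (v + 1) :: t ∈ seqs (m + 1) (N + 1) :=
      mem_seqs.2 ⟨by simpa using hlen, hnd.2, fun x hx => hlt x (List.mem_cons_of_mem _ hx)⟩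
    simp only [List.headD_cons, List.tail_cons] at hs ⊢
    refine ⟨⟨map_mem_seqs htail ?_ ?_, ?_⟩, ?_⟩
    · intro x hx y hy hxy
      rw [← raise_lower (hv x hx), ← raise_lower (hv y hy), hxy]
    · intro x hx
      have := hlt x (List.mem_cons_of_mem _ hx)
      grind [lower]
    · rw [List.map_cons, List.tail_cons]
      refine Spread.map (spread_iff_tail.1 hs).1 fun x hx y hy hxy => ?_
      have := hv x (List.mem_cons_of_mem _ hx)
      have := hv y (List.mem_cons_of_mem _ hy)
      have := hv' x hx
      have := hv' y hy
      simp only [lower]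
      split_ifs <;> omega
    · rcases t with _ | ⟨b, t⟩
      · simp [StartsUp]
      · have h₁ := hv b (by simp)
        have h₂ := (spread_iff_tail.1 hs).2.1
        rw [startsUp_cons_cons] at h₂
        simp only [List.map_cons, startsUp_cons_cons, lower]
        split_ifs <;> omega
  · intro g hg
    simp only [upSeqs, tailSpreadSeqs, Finset.mem_coe, Finset.mem_filter] at hg ⊢
    obtain ⟨⟨hg, hs⟩, hu⟩ := hg
    rcases g with _ | ⟨v, t⟩
    · simp [mem_seqs] at hg
    have hg' := mem_seqs.1 hg
    have hv : ∀ x ∈ t, x ≠ v := fun x hx hxv => (List.nodup_cons.1 hg'.2.1).1 (hxv ▸ hx)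
    have hraise : ∀ x, raise v x ≠ v := by grind [raise]
    have hmap : (v :: t).map (raise v) ∈ seqs (m + 1) (N + 1) := by
      refine map_mem_seqs hg ?_ ?_
      · intro x _ y _ hxy
        rw [← lower_raise v x, ← lower_raise v y, hxy]
      · intro x hx
        have := hg'.2.2 x hx
        simp only [raise]
        split_ifs <;> omega
    simp only [List.headD_cons, List.tail_cons] at hs ⊢
    refine ⟨⟨?_, ?_⟩, v, t.map (raise v), by simp [raise]⟩
    · rw [mem_seqs] at hmap ⊢
      refine ⟨by simpa using hmap.1, List.nodup_cons.2 ⟨?_, hmap.2.1⟩, ?_⟩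
      · rw [List.mem_map]
        rintro ⟨x, -, hx⟩
        exact hraise x hx
      · intro x hx
        rcases List.mem_cons.1 hx with rfl | hx
        · have := hg'.2.2 x (by simp)
          omega
        · exact hmap.2.2 x hx
    · rw [spread_iff_tail, List.map_cons, List.tail_cons]
      refine ⟨hs.map fun x hx y hy hxy => ?_, ?_⟩
      · have := hv x hx
        have := hv y hy
        simp only [raise]
        split_ifs <;> omega
      · rcases t with _ | ⟨b, t⟩
        · simp [StartsUp, StartsDown]
        · have := hv b (by simp)
          simp only [List.map_cons, startsUp_cons_cons, startsDown_cons_cons, raise] at hu ⊢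
          constructor <;> split_ifs <;> omega
  · intro l hl
    simp only [upSeqs, tailSpreadSeqs, Finset.mem_coe, Finset.mem_filter, mem_seqs] at hl
    obtain ⟨⟨hl, hs⟩, v, t, rfl⟩ := hl
    have hnd := List.nodup_cons.1 hl.2.1
    have hmap : (((v + 1) :: t).map (lower v)).map (raise v) = (v + 1) :: t := by
      rw [List.map_map]
      exact (List.map_congr_left fun x hx =>
        raise_lower fun hxv : x = v => hnd.1 (by rwa [hxv] at hx)).trans (List.map_id _)
    have hhead : (((v + 1) :: t).map (lower v)).headD 0 = v := by simp [lower]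
    simp only [List.headD_cons, List.tail_cons, hhead, hmap]
  · intro g _
    simp only [List.headD_cons, List.tail_cons, List.map_map]
    exact (List.map_congr_left fun x _ => lower_raise _ x).trans (List.map_id _)

/-- The coefficient of `y ^ r` in `((1 + y) / (1 - y)) ^ k`: the number of compositions of `r` into
`k` parts `≥ 0`, where every positive part counts twice. -/
def blockWeight (k r : ℕ) : ℤ :=
  ∑ c ∈ Finset.range (r + 1), 2 ^ c * (chooseShift r c : ℤ) * (Nat.choose k c : ℤ)

lemma blockWeight_zero_right (k : ℕ) : blockWeight k 0 = 1 := by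
  simp [blockWeight, chooseShift]

lemma blockWeight_succ_right (k r : ℕ) :
    blockWeight k (r + 1) =
      ∑ c ∈ Finset.range (r + 1), 2 ^ (c + 1) * (Nat.choose r c : ℤ) * (Nat.choose k (c + 1) : ℤ) := by
  rw [blockWeight, Finset.sum_range_succ']
  simp [chooseShift]

lemma blockWeight_zero_succ (r : ℕ) : blockWeight 0 (r + 1) = 0 := by
  simp [blockWeight_succ_right]

lemma blockWeight_succ_succ (k r : ℕ) :
    blockWeight (k + 1) (r + 1) =
      blockWeight k (r + 1) + blockWeight k r + blockWeight (k + 1) r := by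
  cases r with
  | zero => simp [blockWeight_succ_right, blockWeight_zero_right]; ring
  | succ r =>
    have h : blockWeight (k + 1) (r + 2) = blockWeight k (r + 2) +
        ∑ c ∈ Finset.range (r + 2), 2 ^ (c + 1) * (Nat.choose (r + 1) c : ℤ) * (Nat.choose k c : ℤ) := by
      simp only [blockWeight_succ_right, ← Finset.sum_add_distrib, Nat.choose_succ_succ' k]
      refine Finset.sum_congr rfl fun c _ => ?_
      push_cast; ring
    have h₂ : ∑ c ∈ Finset.range (r + 2),
          2 ^ (c + 1) * (Nat.choose (r + 1) c : ℤ) * (Nat.choose k c : ℤ) =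
        (∑ c ∈ Finset.range (r + 1), 2 ^ (c + 1) * (Nat.choose r c : ℤ) * (Nat.choose k c : ℤ)) +
        ∑ c ∈ Finset.range (r + 1),
          2 ^ (c + 2) * (Nat.choose r c : ℤ) * (Nat.choose k (c + 1) : ℤ) := by
      have h₃ : ∑ c ∈ Finset.range (r + 1),
            2 ^ (c + 1) * (Nat.choose r c : ℤ) * (Nat.choose k c : ℤ) =
          ∑ c ∈ Finset.range (r + 2),
            2 ^ (c + 1) * (Nat.choose r c : ℤ) * (Nat.choose k c : ℤ) := by
        rw [Finset.sum_range_succ _ (r + 1)]; simp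
      rw [h₃, Finset.sum_range_succ', Finset.sum_range_succ' _ (r + 1), add_right_comm,
        ← Finset.sum_add_distrib]
      congr 1
      · refine Finset.sum_congr rfl fun c _ => ?_
        rw [Nat.choose_succ_succ' r]; push_cast; ring
      · simp
    rw [h, h₂, blockWeight_succ_right k r, blockWeight_succ_right (k + 1) r, add_assoc,
      add_right_inj, ← Finset.sum_add_distrib, ← Finset.sum_add_distrib]
    refine Finset.sum_congr rfl fun c _ => ?_
    rw [Nat.choose_succ_succ' k]; push_cast; ring

/-- Alternating sum over block structures with `j` additional unconstrained items. -/
def blockSum (j m : ℕ) : ℤ :=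
  ∑ p ∈ Finset.HasAntidiagonal.antidiagonal m, (-1) ^ p.2 * (Nat.factorial (j + p.1) : ℤ) * blockWeight p.1 p.2

lemma blockSum_zero (j : ℕ) : blockSum j 0 = (Nat.factorial j : ℤ) := by
  simp [blockSum, blockWeight_zero_right]

lemma blockSum_one (j : ℕ) : blockSum j 1 = (Nat.factorial (j + 1) : ℤ) := by
  simp [blockSum, Finset.Nat.sum_antidiagonal_succ, blockWeight_zero_right, blockWeight_zero_succ]

lemma blockSum_add_two (j m : ℕ) :
    blockSum j (m + 2) + blockSum j (m + 1) = blockSum (j + 1) (m + 1) - blockSum (j + 1) m := by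
  have h₁ : blockSum j (m + 1) = ∑ p ∈ Finset.HasAntidiagonal.antidiagonal m,
      (-1) ^ p.2 * (Nat.factorial (j + 1 + p.1) : ℤ) * blockWeight (p.1 + 1) p.2 := by
    rw [blockSum, Finset.Nat.sum_antidiagonal_succ]
    simp [blockWeight_zero_succ, add_comm, add_left_comm]
  have h₂ : blockSum (j + 1) (m + 1) = (Nat.factorial (j + m + 2) : ℤ) +
      ∑ p ∈ Finset.HasAntidiagonal.antidiagonal m,
        (-1) ^ (p.2 + 1) * (Nat.factorial (j + 1 + p.1) : ℤ) * blockWeight p.1 (p.2 + 1) := by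
    rw [blockSum, Finset.Nat.sum_antidiagonal_succ']
    simp only [blockWeight_zero_right, pow_zero, one_mul, mul_one]
    ring_nf
  have h₃ : blockSum j (m + 2) = (Nat.factorial (j + m + 2) : ℤ) +
      ∑ p ∈ Finset.HasAntidiagonal.antidiagonal m,
        (-1) ^ (p.2 + 1) * (Nat.factorial (j + 1 + p.1) : ℤ) *
          blockWeight (p.1 + 1) (p.2 + 1) := by
    rw [blockSum, Finset.Nat.sum_antidiagonal_succ, Finset.Nat.sum_antidiagonal_succ']
    simp only [blockWeight_zero_right, blockWeight_zero_succ, pow_zero, one_mul, mul_one, mul_zero,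
      zero_add]
    ring_nf
  rw [h₁, h₂, h₃, blockSum, add_assoc, add_sub_assoc, add_right_inj, ← Finset.sum_add_distrib,
    ← Finset.sum_sub_distrib]
  refine Finset.sum_congr rfl fun p _ => ?_
  rw [blockWeight_succ_succ]; ring

lemma blockSum_zero_left (n : ℕ) (hn : 1 ≤ n) :
    blockSum 0 n = ∑ r ∈ Finset.range n, ∑ c ∈ Finset.range (r + 1),
        (-1 : ℤ) ^ r * 2 ^ c * (Nat.factorial (n - r) : ℤ) * (chooseShift r c : ℤ) *
          (Nat.choose (n - r) c : ℤ) := by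
  obtain ⟨m, rfl⟩ := Nat.exists_eq_add_of_le' hn
  rw [blockSum, ← Finset.Nat.sum_antidiagonal_swap,
    Finset.Nat.sum_antidiagonal_eq_sum_range_succ_mk, Finset.sum_range_succ]
  simp only [Prod.swap_prod_mk, Nat.sub_self, blockWeight_zero_succ, mul_zero, add_zero, zero_add]
  refine Finset.sum_congr rfl fun r _ => ?_
  rw [blockWeight, Finset.mul_sum]
  refine Finset.sum_congr rfl fun c _ => ?_
  ring

lemma card_spreadSeqs_zero (N : ℕ) : (spreadSeqs 0 N).card = 1 := by
  simp [spreadSeqs, seqs, Finset.filter_singleton, Spread]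

lemma card_upSeqs_zero (N : ℕ) : (upSeqs 0 N).card = 0 := by
  rw [Finset.card_eq_zero, Finset.eq_empty_iff_forall_notMem]
  intro l hl
  simp only [upSeqs, tailSpreadSeqs, Finset.mem_filter, mem_seqs] at hl
  obtain ⟨⟨⟨hlen, -⟩, -⟩, a, t, rfl⟩ := hl
  simp at hlen

lemma card_spreadSeqs_succ_add (j m : ℕ) :
    (spreadSeqs (m + 1) (m + 1 + j)).card + 2 * (upSeqs m (m + 1 + j)).card =
      (j + 1) * (spreadSeqs m (m + (j + 1))).card := by
  have h := card_tailSpreadSeqs_eq_add m (m + 1 + j)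
  rw [card_tailSpreadSeqs, card_downSeqs, show m + 1 + j - m = j + 1 by omega] at h
  rw [show m + (j + 1) = m + 1 + j by omega]
  omega

lemma card_spreadSeqs_one (j : ℕ) : (spreadSeqs 1 (1 + j)).card = j + 1 := by
  have h := card_spreadSeqs_succ_add j 0
  simpa [card_spreadSeqs_zero, card_upSeqs_zero] using h

lemma card_spreadSeqs_add_two (j m : ℕ) :
    ((spreadSeqs (m + 2) (m + 2 + j)).card : ℤ) + (spreadSeqs (m + 1) (m + 1 + j)).card =
      (j + 1) * ((spreadSeqs (m + 1) (m + 1 + (j + 1))).card -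
        (spreadSeqs m (m + (j + 1))).card) := by
  have h₁ := card_spreadSeqs_succ_add j m
  have h₂ := card_spreadSeqs_succ_add j (m + 1)
  have h₃ := card_upSeqs_add m (m + 1 + j)
  rw [card_tailSpreadSeqs, show m + 1 + j - m = j + 1 by omega,
    show m + 1 + j + 1 = m + 1 + 1 + j by omega] at h₃
  rw [show m + (j + 1) = m + 1 + j by omega] at *
  zify at h₁ h₂ h₃
  linarith

lemma factorial_mul_card_spreadSeqs (j m : ℕ) :
    (Nat.factorial j : ℤ) * (spreadSeqs m (m + j)).card = blockSum j m := by
  induction m using Nat.twoStepInduction generalizing j with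
  | zero => rw [blockSum_zero, card_spreadSeqs_zero]; simp
  | one => rw [blockSum_one, card_spreadSeqs_one, Nat.factorial_succ]; push_cast; ring
  | more m ih₁ ih₂ =>
    have h := blockSum_add_two j m
    rw [← ih₁, ← ih₂, ← ih₂, Nat.factorial_succ] at h
    have h' := card_spreadSeqs_add_two j m
    push_cast at h
    linear_combination (Nat.factorial j : ℤ) * h' - h

lemma A_one_eq_card_spreadSeqs (n : ℕ) : A n 1 = (spreadSeqs n n).card := by
  rw [A, ← Set.ncard_coe_finset]
  refine Set.ncard_congr (fun π _ => List.ofFn fun i => (π i : ℕ)) ?_ ?_ ?_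
  · intro π hπ
    simp only [spreadSeqs, Finset.mem_coe, Finset.mem_filter, mem_seqs]
    refine ⟨⟨by simp, ?_, ?_⟩, ?_⟩
    · exact List.nodup_ofFn.2 (Fin.val_injective.comp π.injective)
    · simp [List.mem_ofFn]
    · rw [Spread, List.isChain_ofFn]
      intro i hi
      have := hπ ⟨i, by omega⟩ hi
      simp only at this
      omega
  · intro π σ _ _ h
    ext i
    exact congrFun (List.ofFn_injective h) i
  · intro l hl
    simp only [spreadSeqs, Finset.mem_coe, Finset.mem_filter, mem_seqs] at hl
    obtain ⟨⟨rfl, hnd, hlt⟩, hs⟩ := hl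
    let f : Fin l.length → Fin l.length := fun i => ⟨l.get i, hlt _ (List.get_mem l i)⟩
    have hf : Function.Injective f := fun i j h =>
      List.nodup_iff_injective_get.1 hnd (congrArg Fin.val h)
    refine ⟨Equiv.ofBijective f (Finite.injective_iff_bijective.1 hf), ?_, ?_⟩
    · intro i hi
      have := (List.isChain_iff_getElem.1 hs) i hi
      simp only [Equiv.ofBijective_apply, f, List.get_eq_getElem]
      omega
    · exact List.ofFn_get l

/-- Robbins' formula for `a_{n,1}`. -/
theorem a_n1_formula (n : ℕ) (hn : 1 ≤ n) :
    (A n 1 : ℤ) =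
      ∑ r ∈ Finset.range n, ∑ c ∈ Finset.range (r + 1),
        (-1 : ℤ) ^ r * 2 ^ c * (Nat.factorial (n - r) : ℤ) * (chooseShift r c : ℤ) *
          (Nat.choose (n - r) c : ℤ) := by
  rw [A_one_eq_card_spreadSeqs, ← blockSum_zero_left n hn, ← factorial_mul_card_spreadSeqs]
  simp
end

section
/- For every integer n ≥ 3, a_{n,0} = Σ_{r=0}^{n−1} Σ_{c=0}^{r} (−1)^r 2^c (n−r)! C(r−1, c−1) C(n−r, c) · (n/(n−r))² + (−1)^n · 2n, with the convention that C(k, −1) = 0 for every integer k ≠ −1 and C(−1, −1) = 1. -/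
/-- `a_{n,0}`: the number of permutations `π` of `{1,…,n}` (realized as permutations of
`ZMod n`) such that `π(i+1) − π(i) ≢ ±1 (mod n)` for all `i`, indices taken cyclically. -/
noncomputable def A0 (n : ℕ) : ℕ :=
  Set.ncard {π : Equiv.Perm (ZMod n) |
    ∀ i : ZMod n, π (i + 1) - π i ≠ 1 ∧ π (i + 1) - π i ≠ -1}

/-- The permutation of values sending each value of `π` to the cyclically next one. -/
def cyclicSucc {n : ℕ} (π : Equiv.Perm (ZMod n)) : Equiv.Perm (ZMod n) :=
  π.symm.trans ((Equiv.addRight 1).trans π)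

theorem cyclicSucc_apply {n : ℕ} (π : Equiv.Perm (ZMod n)) (x : ZMod n) :
    cyclicSucc π x = π (π.symm x + 1) := rfl

theorem cyclicSucc_apply_apply {n : ℕ} (π : Equiv.Perm (ZMod n)) (i : ZMod n) :
    cyclicSucc π (π i) = π (i + 1) := by simp [cyclicSucc_apply]

theorem mem_of_cyclicSucc_closed {n : ℕ} [NeZero n] (π : Equiv.Perm (ZMod n)) (U : Set (ZMod n))
    (hU : ∀ v ∈ U, cyclicSucc π v ∈ U) {y : ZMod n} (hy : y ∈ U) (v : ZMod n) : v ∈ U := by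
  have key : ∀ k : ℕ, π (π.symm y + k) ∈ U := by
    intro k
    induction k with
    | zero => simpa using hy
    | succ k ih =>
      have := hU _ ih
      rw [cyclicSucc_apply_apply] at this
      simpa [add_assoc] using this
  have := key (π.symm v - π.symm y).val
  simpa using this

theorem eq_of_cyclicSucc_eq {n : ℕ} [NeZero n] {π ρ : Equiv.Perm (ZMod n)}
    (h : cyclicSucc π = cyclicSucc ρ) (h0 : π 0 = ρ 0) : π = ρ := by
  have key : ∀ k : ℕ, π k = ρ k := by
    intro k
    induction k with
    | zero => simpa using h0
    | succ k ih =>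
      rw [Nat.cast_succ, ← cyclicSucc_apply_apply, ← cyclicSucc_apply_apply, h, ih]
  ext v
  have := key v.val
  simp only [ZMod.natCast_val, ZMod.cast_id', id_eq] at this
  rw [this]

/-- The permutations of `ZMod n` whose cyclic successor map contains all edges of `E`. -/
def extensions (n : ℕ) [NeZero n] (E : Finset (ZMod n × ZMod n)) :
    Finset (Equiv.Perm (ZMod n)) :=
  Finset.univ.filter fun π => ∀ e ∈ E, cyclicSucc π e.1 = e.2

theorem mem_extensions {n : ℕ} [NeZero n] {E : Finset (ZMod n × ZMod n)}
    {π : Equiv.Perm (ZMod n)} : π ∈ extensions n E ↔ ∀ e ∈ E, cyclicSucc π e.1 = e.2 := by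
  simp [extensions]

/-- A set of directed edges is a disjoint union of directed paths. -/
structure IsPathSystem {V : Type*} (E : Finset (V × V)) : Prop where
  out_unique : ∀ e ∈ E, ∀ e' ∈ E, e.1 = e'.1 → e = e'
  in_unique : ∀ e ∈ E, ∀ e' ∈ E, e.2 = e'.2 → e = e'
  acyclic : ∃ h : V → ℤ, ∀ e ∈ E, h e.1 < h e.2

/-- Reachability along the edges of `E`. -/
def Reaches {V : Type*} (E : Finset (V × V)) : V → V → Prop :=
  Relation.ReflTransGen fun a b => (a, b) ∈ E

namespace IsPathSystem

variable {V : Type*} {E : Finset (V × V)}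

theorem mono {E' : Finset (V × V)} (hE : IsPathSystem E) (h : E' ⊆ E) : IsPathSystem E' where
  out_unique e he e' he' := hE.out_unique e (h he) e' (h he')
  in_unique e he e' he' := hE.in_unique e (h he) e' (h he')
  acyclic := hE.acyclic.imp fun _ hh e he => hh e (h he)

theorem le_of_reaches {h : V → ℤ} (hh : ∀ e ∈ E, h e.1 < h e.2) {a b : V}
    (hab : Reaches E a b) : h a ≤ h b := by
  induction hab with
  | refl => exact le_rfl
  | tail _ hbc ih => exact ih.trans (hh _ hbc).le

theorem insert [DecidableEq V] (hE : IsPathSystem E) {x y : V} (hx : ∀ e ∈ E, e.1 ≠ x)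
    (hy : ∀ e ∈ E, e.2 ≠ y) (hyx : ¬ Reaches E y x) : IsPathSystem (insert (x, y) E) where
  out_unique := by
    intro e he e' he' hee
    rw [Finset.mem_insert] at he he'
    rcases he with rfl | he <;> rcases he' with rfl | he'
    · rfl
    · exact absurd hee.symm (hx _ he')
    · exact absurd hee (hx _ he)
    · exact hE.out_unique _ he _ he' hee
  in_unique := by
    intro e he e' he' hee
    rw [Finset.mem_insert] at he he'
    rcases he with rfl | he <;> rcases he' with rfl | he'
    · rfl
    · exact absurd hee.symm (hy _ he')
    · exact absurd hee (hy _ he)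
    · exact hE.in_unique _ he _ he' hee
  acyclic := by
    classical
    obtain ⟨h, hh⟩ := hE.acyclic
    refine ⟨fun v => h v + if Reaches E y v then |h x - h y| + 1 else 0, ?_⟩
    intro e he
    rw [Finset.mem_insert] at he
    rcases he with rfl | he
    · have hyy : Reaches E y y := Relation.ReflTransGen.refl
      simp only [hyx, hyy, if_true, if_false]
      have := le_abs_self (h x - h y)
      lia
    · have h1 := hh e he
      by_cases hr : Reaches E y e.1
      · have hr' : Reaches E y e.2 := hr.tail he
        simp only [hr, hr', if_true]
        lia
      · have := abs_nonneg (h x - h y)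
        simp only [hr, if_false]
        split_ifs <;> lia

theorem existsUnique_start [Finite V] (hE : IsPathSystem E) (x : V) :
    ∃! y, (∀ e ∈ E, e.2 ≠ y) ∧ Reaches E y x := by
  obtain ⟨h, hh⟩ := hE.acyclic
  obtain ⟨y, hyx, hmin⟩ := Set.exists_min_image {y | Reaches E y x} h (Set.toFinite _)
    ⟨x, Relation.ReflTransGen.refl⟩
  have hy : ∀ e ∈ E, e.2 ≠ y := by
    rintro ⟨a, b⟩ he rfl
    have h1 : Reaches E a x := Relation.ReflTransGen.head he hyx
    exact absurd (hmin a h1) (not_le.mpr (hh _ he))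
  have start : ∀ {a b : V}, Reaches E a b → (∀ e ∈ E, e.2 ≠ b) → a = b := by
    intro a b hab hb
    rcases Relation.ReflTransGen.cases_tail hab with h | ⟨c, -, hc⟩
    · exact h.symm
    · exact absurd rfl (hb _ hc)
  refine ⟨y, ⟨hy, hyx⟩, ?_⟩
  rintro z ⟨hz, hzx⟩
  have U : Relator.RightUnique (Function.swap fun a b => (a, b) ∈ E) := by
    intro a b c hb hc
    exact congrArg Prod.fst (hE.in_unique _ hb _ hc rfl)
  rcases Relation.ReflTransGen.total_of_right_unique U
    (Relation.reflTransGen_swap.mpr hyx) (Relation.reflTransGen_swap.mpr hzx) with h1 | h1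
  · exact start (Relation.reflTransGen_swap.mp h1) hy
  · exact (start (Relation.reflTransGen_swap.mp h1) hz).symm

theorem card_image_fst [DecidableEq V] (hE : IsPathSystem E) :
    (E.image Prod.fst).card = E.card :=
  Finset.card_image_of_injOn fun e he e' he' h => hE.out_unique e he e' he' h

theorem card_image_snd [DecidableEq V] (hE : IsPathSystem E) :
    (E.image Prod.snd).card = E.card :=
  Finset.card_image_of_injOn fun e he e' he' h => hE.in_unique e he e' he' h

open Classical in
theorem card_nonclosing [Fintype V] (hE : IsPathSystem E) (x : V) :
    (Finset.univ.filter fun y => (∀ e ∈ E, e.2 ≠ y) ∧ ¬ Reaches E y x).card + 1 + E.card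
      = Fintype.card V := by
  obtain ⟨y, ⟨hy, hyx⟩, huniq⟩ := hE.existsUnique_start x
  have h1 : Finset.univ.filter (fun y => (∀ e ∈ E, e.2 ≠ y) ∧ ¬ Reaches E y x)
      = ((E.image Prod.snd)ᶜ).erase y := by
    ext z
    simp only [Finset.mem_filter, Finset.mem_univ, true_and, Finset.mem_erase,
      Finset.mem_compl, Finset.mem_image, not_exists, not_and]
    constructor
    · rintro ⟨h1, h2⟩
      exact ⟨fun h => h2 (h ▸ hyx), h1⟩
    · rintro ⟨h1, h2⟩
      exact ⟨h2, fun h => h1 (huniq z ⟨h2, h⟩)⟩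
  have hmem : y ∈ (E.image Prod.snd)ᶜ := by
    simpa using fun a h => hy (a, y) h rfl
  rw [h1, Finset.card_erase_add_one hmem, ← hE.card_image_snd, add_comm,
    Finset.card_add_card_compl]

end IsPathSystem

section Extensions

variable {n : ℕ} [NeZero n] {E : Finset (ZMod n × ZMod n)}

theorem extensions_insert_eq_empty_of_reaches (hE : IsPathSystem E) (hcard : E.card + 1 < n)
    {x y : ZMod n} (hx : ∀ e ∈ E, e.1 ≠ x) (hyx : Reaches E y x) :
    extensions n (insert (x, y) E) = ∅ := by
  rw [Finset.eq_empty_iff_forall_notMem]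
  intro π hπ
  rw [mem_extensions] at hπ
  have hπE : ∀ e ∈ E, cyclicSucc π e.1 = e.2 := fun e he => hπ e (Finset.mem_insert_of_mem he)
  have hxy : cyclicSucc π x = y := hπ (x, y) (Finset.mem_insert_self _ _)
  have U : Relator.RightUnique fun a b => (a, b) ∈ E := by
    intro a b c hb hc
    exact congrArg Prod.snd (hE.out_unique _ hb _ hc rfl)
  have key : ∀ v, Reaches E y v ∧ (v = x ∨ (v, cyclicSucc π v) ∈ E) := by
    have out : ∀ v, Reaches E y v → v = x ∨ (v, cyclicSucc π v) ∈ E := by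
      intro v hv
      rcases Relation.ReflTransGen.total_of_right_unique U hv hyx with h | h
      · rcases Relation.ReflTransGen.cases_head h with h | ⟨w, hw, -⟩
        · exact Or.inl h
        · right
          rwa [show cyclicSucc π v = w from hπE _ hw]
      · rcases Relation.ReflTransGen.cases_head h with h | ⟨w, hw, -⟩
        · exact Or.inl h.symm
        · exact absurd rfl (hx _ hw)
    intro v
    have hv : v ∈ {v | Reaches E y v} := by
      refine mem_of_cyclicSucc_closed π _ ?_ (y := y) Relation.ReflTransGen.refl v
      intro w hw
      rcases out w hw with rfl | h
      · rw [hxy]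
        exact Relation.ReflTransGen.refl
      · exact Relation.ReflTransGen.tail hw h
    exact ⟨hv, out v hv⟩
  have hsub : Finset.univ.erase x ⊆ E.image Prod.fst := by
    intro v hv
    rcases (key v).2 with h | h
    · exact absurd h (Finset.ne_of_mem_erase hv)
    · exact Finset.mem_image_of_mem _ h
  have := Finset.card_le_card hsub
  rw [Finset.card_erase_of_mem (Finset.mem_univ _), hE.card_image_fst, Finset.card_univ,
    ZMod.card] at this
  lia

theorem extensions_insert_eq_empty_of_mem {x y : ZMod n} (hx : ∀ e ∈ E, e.1 ≠ x)
    {e : ZMod n × ZMod n} (he : e ∈ E) (hey : e.2 = y) :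
    extensions n (insert (x, y) E) = ∅ := by
  rw [Finset.eq_empty_iff_forall_notMem]
  intro π hπ
  rw [mem_extensions] at hπ
  refine hx e he ((cyclicSucc π).injective ?_)
  rw [hπ e (Finset.mem_insert_of_mem he), hπ (x, y) (Finset.mem_insert_self _ _), hey]

open Classical in
theorem card_extensions_eq_sum (hE : IsPathSystem E) (hcard : E.card + 1 < n)
    {x : ZMod n} (hx : ∀ e ∈ E, e.1 ≠ x) :
    (extensions n E).card =
      ∑ y ∈ Finset.univ.filter (fun y => (∀ e ∈ E, e.2 ≠ y) ∧ ¬ Reaches E y x),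
        (extensions n (insert (x, y) E)).card := by
  rw [Finset.card_eq_sum_card_fiberwise (f := fun π => cyclicSucc π x) (t := Finset.univ)
    fun _ _ => Finset.mem_coe.mpr (Finset.mem_univ _)]
  have h1 : ∀ y, (extensions n E).filter (fun π => cyclicSucc π x = y)
      = extensions n (insert (x, y) E) := by
    intro y
    ext π
    simp only [Finset.mem_filter, mem_extensions, Finset.forall_mem_insert]
    tauto
  simp only [h1]
  symm
  apply Finset.sum_subset (Finset.subset_univ _)
  intro y _ hy
  rw [Finset.card_eq_zero]
  by_cases h : ∀ e ∈ E, e.2 ≠ y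
  · refine extensions_insert_eq_empty_of_reaches hE hcard hx ?_
    by_contra h2
    exact hy (Finset.mem_filter.mpr ⟨Finset.mem_univ _, h, h2⟩)
  · push Not at h
    obtain ⟨e, he, hey⟩ := h
    exact extensions_insert_eq_empty_of_mem hx he hey

theorem card_extensions_le_of_forall_cyclicSucc_eq
    (h : ∀ π ∈ extensions n E, ∀ ρ ∈ extensions n E, cyclicSucc π = cyclicSucc ρ) :
    (extensions n E).card ≤ n := by
  have h1 : (extensions n E).card ≤ (Finset.univ : Finset (ZMod n)).card :=
    Finset.card_le_card_of_injOn (fun π => π 0) (fun _ _ => Finset.mem_coe.mpr (Finset.mem_univ _))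
      fun π hπ ρ hρ h0 => eq_of_cyclicSucc_eq (h π hπ ρ hρ) h0
  rwa [Finset.card_univ, ZMod.card] at h1

theorem card_extensions_le (m : ℕ) : ∀ {E : Finset (ZMod n × ZMod n)}, IsPathSystem E →
    E.card + (m + 1) = n → (extensions n E).card ≤ n * m.factorial := by
  classical
  induction m with
  | zero =>
    intro E hE hcard
    rw [Nat.factorial_zero, mul_one]
    apply card_extensions_le_of_forall_cyclicSucc_eq
    intro π hπ ρ hρ
    rw [mem_extensions] at hπ hρ
    have hc : ((E.image Prod.fst)ᶜ).card = 1 := by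
      rw [Finset.card_compl, hE.card_image_fst, ZMod.card]
      lia
    obtain ⟨x, hx⟩ := Finset.card_eq_one.mp hc
    have agree : ∀ v, v ≠ x → cyclicSucc π v = cyclicSucc ρ v := by
      intro v hv
      have : v ∈ E.image Prod.fst := by
        by_contra h
        rw [← Finset.mem_compl, hx, Finset.mem_singleton] at h
        exact hv h
      obtain ⟨e, he, rfl⟩ := Finset.mem_image.mp this
      rw [hπ e he, hρ e he]
    refine Equiv.ext fun v => ?_
    by_cases hv : v = x
    · subst hv
      obtain ⟨w, hw⟩ := (cyclicSucc ρ).surjective (cyclicSucc π v)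
      by_cases hwv : w = v
      · rw [← hw, hwv]
      · rw [← agree w hwv] at hw
        exact absurd ((cyclicSucc π).injective hw) hwv
    · exact agree v hv
  | succ m ih =>
    intro E hE hcard
    have hne : E.image Prod.fst ≠ Finset.univ := by
      intro h
      have := congrArg Finset.card h
      rw [hE.card_image_fst, Finset.card_univ, ZMod.card] at this
      lia
    obtain ⟨x, hx⟩ : ∃ x, x ∉ E.image Prod.fst := by
      by_contra! h
      exact hne (Finset.eq_univ_of_forall h)
    have hx' : ∀ e ∈ E, e.1 ≠ x := by
      rintro e he rfl
      exact hx (Finset.mem_image_of_mem _ he)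
    have hcount := hE.card_nonclosing x
    rw [ZMod.card] at hcount
    rw [card_extensions_eq_sum hE (by lia) hx']
    refine (Finset.sum_le_card_nsmul _ _ (n * m.factorial) ?_).trans ?_
    · intro y hy
      obtain ⟨-, hy1, hy2⟩ := Finset.mem_filter.mp hy
      refine ih (hE.insert hx' hy1 hy2) ?_
      rw [Finset.card_insert_of_notMem fun h => hx' _ h rfl]
      lia
    · rw [show (Finset.univ.filter fun y => (∀ e ∈ E, e.2 ≠ y) ∧ ¬ Reaches E y x).card = m + 1
        by lia, Nat.factorial_succ, smul_eq_mul]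
      exact le_of_eq (by ring)

theorem card_extensions (hE : IsPathSystem E) {m : ℕ} (hcard : E.card + (m + 1) = n) :
    (extensions n E).card = n * m.factorial := by
  classical
  induction E using Finset.induction_on generalizing m with
  | empty =>
    obtain rfl : n = m + 1 := by simpa using hcard.symm
    have : extensions (m + 1) ∅ = Finset.univ := by simp [extensions]
    rw [this, Finset.card_univ, Fintype.card_perm, ZMod.card, Nat.factorial_succ]
  | insert e E heE ih =>
    obtain ⟨x, y⟩ := e
    have hE' : IsPathSystem E := hE.mono (Finset.subset_insert _ _)
    have hx : ∀ e ∈ E, e.1 ≠ x := fun e he h => heE <| by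
      rwa [hE.out_unique (x, y) (Finset.mem_insert_self _ _) e (Finset.mem_insert_of_mem he) h.symm]
    have hy : ∀ e ∈ E, e.2 ≠ y := fun e he h => heE <| by
      rwa [hE.in_unique (x, y) (Finset.mem_insert_self _ _) e (Finset.mem_insert_of_mem he) h.symm]
    have hyx : ¬ Reaches E y x := by
      intro h
      obtain ⟨p, hp⟩ := hE.acyclic
      have h1 := IsPathSystem.le_of_reaches
        (fun e he => hp e (Finset.mem_insert_of_mem he)) h
      exact absurd (hp _ (Finset.mem_insert_self _ _)) (not_lt.mpr h1)
    rw [Finset.card_insert_of_notMem heE] at hcard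
    have hsum := card_extensions_eq_sum hE' (by lia) hx
    rw [ih hE' (m := m + 1) (by lia)] at hsum
    have hcount := hE'.card_nonclosing x
    rw [ZMod.card] at hcount
    have hm : (Finset.univ.filter fun y => (∀ e ∈ E, e.2 ≠ y) ∧ ¬ Reaches E y x).card = m + 1 := by
      lia
    have hle : ∀ z ∈ Finset.univ.filter fun y => (∀ e ∈ E, e.2 ≠ y) ∧ ¬ Reaches E y x,
        (extensions n (insert (x, z) E)).card ≤ n * m.factorial := by
      intro z hz
      obtain ⟨-, hz1, hz2⟩ := Finset.mem_filter.mp hz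
      refine card_extensions_le m (hE'.insert hx hz1 hz2) ?_
      rw [Finset.card_insert_of_notMem fun h => hx _ h rfl]
      lia
    refine (Finset.sum_eq_sum_iff_of_le hle).mp ?_ y
      (Finset.mem_filter.mpr ⟨Finset.mem_univ _, hy, hyx⟩)
    rw [← hsum, Finset.sum_const, hm, Nat.factorial_succ, smul_eq_mul]
    ring

end Extensions

theorem ZMod.two_ne_zero_of_three_le {n : ℕ} (hn : 3 ≤ n) : (2 : ZMod n) ≠ 0 := by
  intro h
  have : ((2 : ℕ) : ZMod n) = 0 := by exact_mod_cast h
  rw [ZMod.natCast_eq_zero_iff] at this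
  exact absurd (Nat.le_of_dvd two_pos this) (by lia)

section Orientations

variable {n : ℕ} [NeZero n]

/-- The directed edges prescribed by `δ`: `x → x + 1` if `δ x = 1`, and `x + 1 → x` if
`δ x = -1`. -/
def orientedEdges (δ : ZMod n → SignType) : Finset (ZMod n × ZMod n) :=
  (Finset.univ.filter fun x => δ x ≠ 0).image fun x => if δ x = 1 then (x, x + 1) else (x + 1, x)

/-- The cyclic word `δ` has no two cyclically consecutive opposite signs. -/
def IsCoherent (δ : ZMod n → SignType) : Prop := ∀ x, δ x * δ (x + 1) ≠ -1

theorem mem_orientedEdges {δ : ZMod n → SignType} {a b : ZMod n} :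
    (a, b) ∈ orientedEdges δ ↔ (δ a = 1 ∧ b = a + 1) ∨ (δ b = -1 ∧ a = b + 1) := by
  simp only [orientedEdges, Finset.mem_image, Finset.mem_filter, Finset.mem_univ, true_and]
  constructor
  · rintro ⟨x, hx, h⟩
    split_ifs at h with h1
    · obtain ⟨rfl, rfl⟩ := Prod.mk.inj h
      exact Or.inl ⟨h1, rfl⟩
    · obtain ⟨rfl, rfl⟩ := Prod.mk.inj h
      refine Or.inr ⟨?_, rfl⟩
      revert hx h1
      generalize δ x = s
      revert s
      decide
  · rintro (⟨h, rfl⟩ | ⟨h, rfl⟩)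
    · exact ⟨a, by simp [h], by simp [h]⟩
    · exact ⟨b, by simp [h], by simp [h]⟩

theorem card_orientedEdges (hn : 3 ≤ n) (δ : ZMod n → SignType) :
    (orientedEdges δ).card = (Finset.univ.filter fun x => δ x ≠ 0).card := by
  have h2 := ZMod.two_ne_zero_of_three_le hn
  apply Finset.card_image_of_injOn
  intro x _ y _ hxy
  simp only at hxy
  split_ifs at hxy
  · exact (Prod.mk.inj hxy).1
  · obtain ⟨h, h'⟩ := Prod.mk.inj hxy
    exact absurd (by linear_combination h' - h) h2
  · obtain ⟨h, h'⟩ := Prod.mk.inj hxy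
    exact absurd (by linear_combination h - h') h2
  · exact (Prod.mk.inj hxy).2

theorem IsCoherent.isPathSystem (hn : 3 ≤ n) {δ : ZMod n → SignType} (hδ : IsCoherent δ)
    {z : ZMod n} (hz : δ z = 0) : IsPathSystem (orientedEdges δ) where
  out_unique := by
    rintro ⟨a, b⟩ hb ⟨a', c⟩ hc (rfl : a = a')
    rw [mem_orientedEdges] at hb hc
    rcases hb with ⟨h1, rfl⟩ | ⟨h1, rfl⟩ <;> rcases hc with ⟨h2, h3⟩ | ⟨h2, h3⟩
    · rw [h3]
    · exact absurd (by rw [← h3, h2, h1]; rfl) (hδ c)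
    · exact absurd (by rw [h2, h1]; rfl) (hδ b)
    · rw [add_right_cancel h3]
  in_unique := by
    rintro ⟨a, b⟩ ha ⟨c, b'⟩ hc (rfl : b = b')
    rw [mem_orientedEdges] at ha hc
    rcases ha with ⟨h1, rfl⟩ | ⟨h1, rfl⟩ <;> rcases hc with ⟨h2, h3⟩ | ⟨h2, h3⟩
    · rw [add_right_cancel h3]
    · exact absurd (by rw [h2, h1]; rfl) (hδ a)
    · exact absurd (by rw [← h3, h2, h1]; rfl) (hδ c)
    · rw [h3]
  acyclic := by
    have step : ∀ x, δ x ≠ 0 → (x + 1 - z - 1).val = (x - z - 1).val + 1 := by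
      intro x hx
      have hxz : x - z ≠ 0 := fun h => hx (by rw [sub_eq_zero.mp h, hz])
      have h1 : (x - z).val = (x - z - 1).val + 1 := by
        have hv : (1 : ZMod n).val = 1 := ZMod.val_one'' (by lia)
        have hlt := ZMod.val_lt (x - z - 1)
        by_cases hc : (x - z - 1).val + (1 : ZMod n).val < n
        · have := ZMod.val_add_of_lt hc
          rwa [sub_add_cancel, hv] at this
        · have := ZMod.val_add_val_of_le (not_lt.mp hc)
          rw [sub_add_cancel, hv] at this
          exact absurd ((ZMod.val_eq_zero _).mp (by lia)) hxz
      rw [← h1]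
      congr 1
      ring
    refine ⟨fun v => if δ v = 1 ∨ δ (v - 1) = 1 then ((v - z - 1).val : ℤ)
      else -((v - z - 1).val : ℤ), ?_⟩
    rintro ⟨a, b⟩ he
    rcases mem_orientedEdges.mp he with ⟨h1, rfl⟩ | ⟨h1, rfl⟩
    · have := step a (by simp [h1])
      simp only [h1, add_sub_cancel_right, true_or, or_true, if_true]
      lia
    · have := step b (by simp [h1])
      have h2 : δ (b + 1) ≠ 1 := fun h => hδ b (by rw [h1, h]; rfl)
      have h3 : δ (b - 1) ≠ 1 := fun h => hδ (b - 1) (by rw [sub_add_cancel, h1, h]; rfl)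
      have h4 : (-1 : SignType) ≠ 1 := by decide
      simp only [h1, h2, h3, h4, add_sub_cancel_right, or_self, if_false]
      lia

theorem extensions_orientedEdges_of_not_isCoherent (hn : 3 ≤ n) {δ : ZMod n → SignType}
    (hδ : ¬ IsCoherent δ) : extensions n (orientedEdges δ) = ∅ := by
  have h2 := ZMod.two_ne_zero_of_three_le hn
  rw [Finset.eq_empty_iff_forall_notMem]
  intro π hπ
  rw [mem_extensions] at hπ
  unfold IsCoherent at hδ
  push Not at hδ
  obtain ⟨x, hx⟩ := hδ
  have key : (δ x = 1 ∧ δ (x + 1) = -1) ∨ (δ x = -1 ∧ δ (x + 1) = 1) := by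
    revert hx
    generalize δ x = s
    generalize δ (x + 1) = t
    revert s t
    decide
  rcases key with ⟨hs, ht⟩ | ⟨hs, ht⟩
  · have e1 := hπ (x, x + 1) (mem_orientedEdges.mpr (Or.inl ⟨hs, rfl⟩))
    have e2 := hπ (x + 1 + 1, x + 1) (mem_orientedEdges.mpr (Or.inr ⟨ht, rfl⟩))
    have := (cyclicSucc π).injective (e1.trans e2.symm)
    exact h2 (by linear_combination -this)
  · have e1 := hπ (x + 1, x) (mem_orientedEdges.mpr (Or.inr ⟨hs, rfl⟩))
    have e2 := hπ (x + 1, x + 1 + 1) (mem_orientedEdges.mpr (Or.inl ⟨ht, rfl⟩))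
    exact h2 (by linear_combination e1 - e2)

theorem card_extensions_const {s : SignType} (hs : s ≠ 0) :
    (extensions n (orientedEdges fun _ => s)).card = n := by
  have hs' : s = 1 ∨ s = -1 := by
    revert s
    decide
  apply le_antisymm
  · apply card_extensions_le_of_forall_cyclicSucc_eq
    intro π hπ ρ hρ
    rw [mem_extensions] at hπ hρ
    refine Equiv.ext fun v => ?_
    rcases hs' with rfl | rfl
    · have hv : (v, v + 1) ∈ orientedEdges fun _ : ZMod n => (1 : SignType) :=
        mem_orientedEdges.mpr (Or.inl ⟨rfl, rfl⟩)
      exact (hπ _ hv).trans (hρ _ hv).symm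
    · have hv : (v, v - 1) ∈ orientedEdges fun _ : ZMod n => (-1 : SignType) :=
        mem_orientedEdges.mpr (Or.inr ⟨rfl, by ring⟩)
      exact (hπ _ hv).trans (hρ _ hv).symm
  · have h10 : (1 : SignType) ≠ -1 := by decide
    have h01 : (-1 : SignType) ≠ 1 := by decide
    have hcard : n = (Finset.univ : Finset (ZMod n)).card := by
      rw [Finset.card_univ, ZMod.card]
    conv_lhs => rw [hcard]
    rcases hs' with rfl | rfl
    · refine Finset.card_le_card_of_injOn Equiv.addRight ?_ ?_
      · intro c _
        rw [Finset.mem_coe, mem_extensions]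
        rintro ⟨a, b⟩ he
        rcases mem_orientedEdges.mp he with ⟨-, rfl⟩ | ⟨h, -⟩
        · simp [cyclicSucc_apply]
          ring
        · exact absurd h h10
      · intro c _ d _ h
        simpa using congrArg (fun e : Equiv.Perm (ZMod n) => e 0) h
    · refine Finset.card_le_card_of_injOn Equiv.subLeft ?_ ?_
      · intro c _
        rw [Finset.mem_coe, mem_extensions]
        rintro ⟨a, b⟩ he
        rcases mem_orientedEdges.mp he with ⟨h, -⟩ | ⟨-, rfl⟩
        · exact absurd h h01
        · simp [cyclicSucc_apply]
          ring
      · intro c _ d _ h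
        simpa using congrArg (fun e : Equiv.Perm (ZMod n) => e 0) h

theorem IsCoherent.eq_const {δ : ZMod n → SignType} (hδ : IsCoherent δ)
    (h0 : ∀ x, δ x ≠ 0) : δ = fun _ => δ 0 := by
  have step : ∀ x, δ (x + 1) = δ x := by
    intro x
    have h1 := hδ x
    have h2 := h0 x
    have h3 := h0 (x + 1)
    revert h1 h2 h3
    generalize δ x = s
    generalize δ (x + 1) = t
    revert s t
    decide
  have key : ∀ k : ℕ, δ k = δ 0 := by
    intro k
    induction k with
    | zero => simp
    | succ k ih => rw [Nat.cast_succ, step, ih]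
  funext v
  simpa using key v.val

theorem A0_eq_sum (hn : 3 ≤ n) :
    (A0 n : ℚ) = ∑ δ : ZMod n → SignType,
      (-1) ^ (Finset.univ.filter fun x => δ x ≠ 0).card
        * ((extensions n (orientedEdges δ)).card : ℚ) := by
  classical
  have h2 := ZMod.two_ne_zero_of_three_le hn
  have hset : {π : Equiv.Perm (ZMod n) |
      ∀ i : ZMod n, π (i + 1) - π i ≠ 1 ∧ π (i + 1) - π i ≠ -1}
      = ↑(Finset.univ.filter fun π : Equiv.Perm (ZMod n) =>
        ∀ x, cyclicSucc π x ≠ x + 1 ∧ cyclicSucc π (x + 1) ≠ x) := by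
    ext π
    simp only [Set.mem_ofPred_eq, Finset.coe_filter, Finset.mem_univ, true_and]
    constructor
    · intro h x
      constructor
      · intro hx
        refine (h (π.symm x)).1 ?_
        rw [← cyclicSucc_apply, hx]
        simp
      · intro hx
        refine (h (π.symm (x + 1))).2 ?_
        rw [← cyclicSucc_apply, hx]
        simp
    · intro h i
      constructor
      · intro hi
        refine (h (π i)).1 ?_
        rw [cyclicSucc_apply_apply]
        linear_combination hi
      · intro hi
        refine (h (π (i + 1))).2 ?_
        rw [show π (i + 1) + 1 = π i by linear_combination hi, cyclicSucc_apply_apply]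
  let w : Equiv.Perm (ZMod n) → ZMod n → SignType → ℚ := fun π x s =>
    if s = 0 then 1 else if s = 1 then (if cyclicSucc π x = x + 1 then -1 else 0)
      else (if cyclicSucc π (x + 1) = x then -1 else 0)
  have hw : ∀ π x, ∑ s, w π x s
      = if cyclicSucc π x ≠ x + 1 ∧ cyclicSucc π (x + 1) ≠ x then 1 else 0 := by
    intro π x
    have huniv : (Finset.univ : Finset SignType) = {0, -1, 1} := rfl
    have h3 : ¬ (cyclicSucc π x = x + 1 ∧ cyclicSucc π (x + 1) = x) := by
      rintro ⟨ha, hb⟩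
      have hmem : x + 2 ∈ ({x, x + 1} : Set (ZMod n)) := by
        refine mem_of_cyclicSucc_closed π _ ?_ (y := x) (Set.mem_insert _ _) _
        rintro v (rfl | rfl)
        · rw [ha]
          exact Set.mem_insert_of_mem _ rfl
        · rw [hb]
          exact Set.mem_insert _ _
      rcases hmem with h | h
      · exact h2 (by linear_combination h)
      · have h : x + 2 = x + 1 := h
        exact h2 (by linear_combination 2 * h)
    have h10 : (1 : SignType) ≠ 0 := by decide
    have h11 : (-1 : SignType) ≠ 0 := by decide
    have h12 : (-1 : SignType) ≠ 1 := by decide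
    rw [huniv, Finset.sum_insert (by decide), Finset.sum_insert (by decide),
      Finset.sum_singleton]
    simp only [w, h10, h11, h12, if_true, if_false]
    by_cases ha : cyclicSucc π x = x + 1 <;> by_cases hb : cyclicSucc π (x + 1) = x <;>
      simp_all
  have hprod : ∀ (π : Equiv.Perm (ZMod n)) (δ : ZMod n → SignType), ∏ x, w π x (δ x)
      = (-1) ^ (Finset.univ.filter fun x => δ x ≠ 0).card
        * if π ∈ extensions n (orientedEdges δ) then 1 else 0 := by
    intro π δ
    split_ifs with h
    · rw [mem_extensions] at h
      rw [mul_one, ← Finset.prod_const, Finset.prod_filter]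
      refine Finset.prod_congr rfl fun x _ => ?_
      rcases SignType.trichotomy (δ x) with hx | hx | hx
      · simp [w, hx, h (x + 1, x) (mem_orientedEdges.mpr (Or.inr ⟨hx, rfl⟩))]
      · simp [w, hx]
      · simp [w, hx, h (x, x + 1) (mem_orientedEdges.mpr (Or.inl ⟨hx, rfl⟩))]
    · rw [mul_zero]
      rw [mem_extensions] at h
      push Not at h
      obtain ⟨⟨a, b⟩, he, hab⟩ := h
      rcases mem_orientedEdges.mp he with ⟨h1, rfl⟩ | ⟨h1, rfl⟩
      · exact Finset.prod_eq_zero (Finset.mem_univ a) (by simpa [w, h1] using hab)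
      · exact Finset.prod_eq_zero (Finset.mem_univ b) (by simpa [w, h1] using hab)
  rw [A0, hset, Set.ncard_coe_finset, Finset.card_filter]
  push_cast
  have h1 : ∀ π : Equiv.Perm (ZMod n),
      (if ∀ x, cyclicSucc π x ≠ x + 1 ∧ cyclicSucc π (x + 1) ≠ x then (1 : ℚ) else 0)
        = ∑ δ : ZMod n → SignType, ∏ x, w π x (δ x) := by
    intro π
    rw [← Fintype.piFinset_univ, ← Finset.prod_univ_sum]
    simp only [hw]
    rw [Finset.prod_ite_zero]
    simp
  simp only [h1]
  rw [Finset.sum_comm]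
  refine Finset.sum_congr rfl fun δ _ => ?_
  simp only [hprod]
  rw [← Finset.mul_sum]
  simp

end Orientations

/-- The coefficient of `t ^ r` in `((1 + t) / (1 - t)) ^ m`. -/
def gapCount (m r : ℕ) : ℕ :=
  ∑ c ∈ Finset.range (r + 1), 2 ^ c * chooseShift r c * m.choose c

/-- The Delannoy number, the coefficient of `t ^ r` in `((1 + t) / (1 - t)) ^ m / (1 - t)`. -/
def delannoy (m r : ℕ) : ℕ :=
  ∑ c ∈ Finset.range (r + 1), 2 ^ c * r.choose c * m.choose c

theorem gapCount_zero_right (m : ℕ) : gapCount m 0 = 1 := by simp [gapCount, chooseShift]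

theorem delannoy_zero_right (m : ℕ) : delannoy m 0 = 1 := by simp [delannoy]

theorem gapCount_succ_right (m r : ℕ) :
    gapCount m (r + 1) = ∑ c ∈ Finset.range (r + 1), 2 ^ (c + 1) * r.choose c * m.choose (c + 1) := by
  rw [gapCount, Finset.sum_range_succ']
  simp [chooseShift]

theorem gapCount_zero_left_succ (r : ℕ) : gapCount 0 (r + 1) = 0 := by
  simp [gapCount_succ_right]

theorem gapCount_succ_succ (m r : ℕ) :
    gapCount (m + 1) (r + 1) = gapCount m (r + 1) + 2 * delannoy m r := by
  rw [gapCount_succ_right, gapCount_succ_right, delannoy, Finset.mul_sum,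
    ← Finset.sum_add_distrib]
  refine Finset.sum_congr rfl fun c _ => ?_
  rw [Nat.choose_succ_succ]
  ring

theorem delannoy_succ_right (m r : ℕ) :
    delannoy m (r + 1) = gapCount m (r + 1) + delannoy m r := by
  have h : delannoy m r = ∑ c ∈ Finset.range (r + 1 + 1), 2 ^ c * r.choose c * m.choose c := by
    rw [Finset.sum_range_succ, delannoy, Nat.choose_succ_self]
    simp
  rw [h, delannoy, gapCount, ← Finset.sum_add_distrib]
  refine Finset.sum_congr rfl fun c _ => ?_
  cases c with
  | zero => simp [chooseShift]
  | succ c =>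
    rw [Nat.choose_succ_succ]
    simp only [chooseShift, Nat.add_eq_zero_iff, one_ne_zero, and_false, if_false,
      Nat.add_sub_cancel]
    ring

/-- The sum of `g (number of zeros of w)` over all sign words `w` of length `k` such that the word
`s w` has no two consecutive opposite signs. -/
def wordSum (k : ℕ) (s : SignType) (g : ℕ → ℚ) : ℚ :=
  ∑ w : Fin k → SignType,
    if ∀ i : Fin k, (Fin.cons s w : Fin (k + 1) → SignType) i.castSucc * w i ≠ -1
      then g (Finset.univ.filter fun i => w i = 0).card else 0

theorem wordSum_zero (s : SignType) (g : ℕ → ℚ) : wordSum 0 s g = g 0 := by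
  simp [wordSum]

theorem sum_cons_eq {k : ℕ} (f : (Fin (k + 1) → SignType) → ℚ) :
    ∑ w, f w = ∑ t : SignType, ∑ w : Fin k → SignType, f (Fin.cons t w) := by
  rw [← (Fin.consEquiv fun _ => SignType).sum_comp, Fintype.sum_prod_type]
  rfl

theorem wordSum_succ (k : ℕ) (s : SignType) (g : ℕ → ℚ) :
    wordSum (k + 1) s g = ∑ t : SignType,
      if s * t ≠ -1 then wordSum k t (fun m => g (if t = 0 then m + 1 else m)) else 0 := by
  rw [wordSum, sum_cons_eq]
  refine Finset.sum_congr rfl fun t _ => ?_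
  have h : ∀ w : Fin k → SignType,
      (∀ i : Fin (k + 1), (Fin.cons s (Fin.cons t w : Fin (k + 1) → SignType) :
        Fin (k + 1 + 1) → SignType) i.castSucc * (Fin.cons t w : Fin (k + 1) → SignType) i ≠ -1)
      ↔ s * t ≠ -1 ∧ ∀ i : Fin k, (Fin.cons t w : Fin (k + 1) → SignType) i.castSucc * w i ≠ -1 := by
    intro w
    rw [Fin.forall_fin_succ]
    simp only [Fin.castSucc_zero, Fin.cons_zero, Fin.cons_succ, ← Fin.succ_castSucc]
  simp only [h, Fin.card_filter_univ_succ, Fin.cons_zero, Fin.cons_succ]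
  by_cases hst : s * t ≠ -1
  · rw [if_pos hst, wordSum]
    refine Finset.sum_congr rfl fun w _ => ?_
    simp [hst]
  · simp [hst]

open Finset.HasAntidiagonal in
theorem wordSum_eq (k : ℕ) : ∀ g : ℕ → ℚ,
    wordSum k 0 g = ∑ p ∈ antidiagonal k, (gapCount (p.1 + 1) p.2 : ℚ) * g p.1 ∧
    wordSum k 1 g = ∑ p ∈ antidiagonal k, (delannoy p.1 p.2 : ℚ) * g p.1 ∧
    wordSum k (-1) g = ∑ p ∈ antidiagonal k, (delannoy p.1 p.2 : ℚ) * g p.1 := by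
  induction k with
  | zero =>
    intro g
    simp [wordSum_zero, gapCount_zero_right, delannoy_zero_right]
  | succ k ih =>
    intro g
    have huniv : (Finset.univ : Finset SignType) = {0, -1, 1} := rfl
    have hsum : ∀ f : SignType → ℚ, ∑ t, f t = f 0 + (f (-1) + f 1) := by
      intro f
      rw [huniv, Finset.sum_insert (by decide), Finset.sum_insert (by decide),
        Finset.sum_singleton]
    have hgap : ∑ p ∈ antidiagonal (k + 1), (gapCount p.1 p.2 : ℚ) * g p.1
        = ∑ p ∈ antidiagonal k, (gapCount (p.1 + 1) p.2 : ℚ) * g (p.1 + 1) := by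
      rw [Finset.Nat.sum_antidiagonal_succ, gapCount_zero_left_succ]
      simp
    have h10 : (1 : SignType) ≠ 0 := by decide
    have h11 : (-1 : SignType) ≠ 0 := by decide
    have m1 : (0 : SignType) * 0 ≠ -1 := by decide
    have m2 : (0 : SignType) * -1 ≠ -1 := by decide
    have m3 : (0 : SignType) * 1 ≠ -1 := by decide
    have m4 : (1 : SignType) * 0 ≠ -1 := by decide
    have m5 : ¬ (1 : SignType) * -1 ≠ -1 := by decide
    have m6 : (1 : SignType) * 1 ≠ -1 := by decide
    have m7 : (-1 : SignType) * 0 ≠ -1 := by decide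
    have m8 : (-1 : SignType) * -1 ≠ -1 := by decide
    have m9 : ¬ (-1 : SignType) * 1 ≠ -1 := by decide
    have hdel : ∑ p ∈ antidiagonal (k + 1), (delannoy p.1 p.2 : ℚ) * g p.1
        = ∑ p ∈ antidiagonal k, (gapCount (p.1 + 1) p.2 : ℚ) * g (p.1 + 1)
          + ∑ p ∈ antidiagonal k, (delannoy p.1 p.2 : ℚ) * g p.1 := by
      rw [← hgap, Finset.Nat.sum_antidiagonal_succ', Finset.Nat.sum_antidiagonal_succ']
      simp only [delannoy_succ_right, delannoy_zero_right, gapCount_zero_right, Nat.cast_add,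
        add_mul, Finset.sum_add_distrib]
      ring
    refine ⟨?_, ?_, ?_⟩
    · rw [wordSum_succ, hsum, if_pos m1, if_pos m2, if_pos m3]
      simp only [if_true, h10, h11, if_false]
      rw [(ih _).1, (ih _).2.1, (ih _).2.2, ← hgap, Finset.Nat.sum_antidiagonal_succ',
        Finset.Nat.sum_antidiagonal_succ']
      simp only [gapCount_succ_succ, gapCount_zero_right, Nat.cast_add, Nat.cast_mul, add_mul,
        Finset.sum_add_distrib, mul_assoc, ← Finset.mul_sum]
      push_cast
      ring
    · rw [wordSum_succ, hsum, if_pos m4, if_neg m5, if_pos m6]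
      simp only [if_true, h10, if_false]
      rw [(ih _).1, (ih _).2.1, hdel, zero_add]
    · rw [wordSum_succ, hsum, if_pos m7, if_pos m8, if_neg m9]
      simp only [if_true, h11, if_false]
      rw [(ih _).1, (ih _).2.2, hdel, add_zero]

open Classical Finset.HasAntidiagonal in
theorem sum_isCoherent_zero (k : ℕ) (g : ℕ → ℚ) :
    (∑ δ : ZMod (k + 1) → SignType,
      if IsCoherent δ ∧ δ 0 = 0 then g (Finset.univ.filter fun x => δ x = 0).card else 0)
      = ∑ p ∈ antidiagonal k, (gapCount (p.1 + 1) p.2 : ℚ) * g (p.1 + 1) := by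
  rw [← (wordSum_eq k fun m => g (m + 1)).1]
  have hcoh : ∀ w : Fin k → SignType,
      IsCoherent (n := k + 1) (Fin.cons 0 w : Fin (k + 1) → SignType) ↔
      ∀ i : Fin k, (Fin.cons 0 w : Fin (k + 1) → SignType) i.castSucc * w i ≠ -1 := by
    intro w
    have h1 : IsCoherent (n := k + 1) (Fin.cons 0 w : Fin (k + 1) → SignType) ↔
      ∀ x : Fin (k + 1), (Fin.cons 0 w : Fin (k + 1) → SignType) x *
        (Fin.cons 0 w : Fin (k + 1) → SignType) (x + 1) ≠ -1 := Iff.rfl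
    rw [h1, Fin.forall_fin_succ']
    have h0 : (0 : SignType) ≠ -1 := by decide
    simp [Fin.coeSucc_eq_succ, h0]
  refine (sum_cons_eq (k := k) fun δ => if IsCoherent (n := k + 1) δ ∧ δ 0 = 0
    then g (Finset.univ.filter fun x => δ x = 0).card else 0).trans ?_
  rw [Finset.sum_eq_single 0]
  · rw [wordSum]
    refine Finset.sum_congr rfl fun w _ => ?_
    simp only [hcoh, Fin.cons_zero, and_true, Fin.card_filter_univ_succ, Fin.cons_succ,
      if_true]
  · intro t _ ht
    simp [ht]
  · simp

open Classical in
theorem sum_isCoherent_mul (n : ℕ) [NeZero n] (g : ℕ → ℚ) :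
    (∑ δ : ZMod n → SignType, if IsCoherent δ then
      ((Finset.univ.filter fun x => δ x = 0).card : ℚ)
        * g (Finset.univ.filter fun x => δ x = 0).card else 0)
      = n * ∑ δ : ZMod n → SignType,
        if IsCoherent δ ∧ δ 0 = 0 then g (Finset.univ.filter fun x => δ x = 0).card else 0 := by
  have h1 : ∀ δ : ZMod n → SignType, (if IsCoherent δ then
      ((Finset.univ.filter fun x => δ x = 0).card : ℚ)
        * g (Finset.univ.filter fun x => δ x = 0).card else 0)
      = ∑ i, if IsCoherent δ ∧ δ i = 0 then g (Finset.univ.filter fun x => δ x = 0).card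
        else 0 := by
    intro δ
    by_cases hδ : IsCoherent δ
    · simp only [hδ, true_and, if_true]
      rw [← Finset.sum_filter, Finset.sum_const, nsmul_eq_mul]
    · simp [hδ]
  have h2 : ∀ i : ZMod n, (∑ δ : ZMod n → SignType,
      if IsCoherent δ ∧ δ i = 0 then g (Finset.univ.filter fun x => δ x = 0).card else 0)
      = ∑ δ : ZMod n → SignType,
        if IsCoherent δ ∧ δ 0 = 0 then g (Finset.univ.filter fun x => δ x = 0).card else 0 := by
    intro i
    refine Fintype.sum_equiv ((Equiv.subRight i).arrowCongr (Equiv.refl _)) _ _ fun δ => ?_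
    have e : ∀ x, ((Equiv.subRight i).arrowCongr (Equiv.refl SignType)) δ x = δ (x + i) := by
      intro x
      simp [Equiv.arrowCongr]
    have hc : IsCoherent (((Equiv.subRight i).arrowCongr (Equiv.refl SignType)) δ)
        ↔ IsCoherent δ := by
      simp only [IsCoherent, e]
      constructor
      · intro h x
        have := h (x - i)
        rwa [sub_add_cancel, show x - i + 1 + i = x + 1 by ring] at this
      · intro h x
        have := h (x + i)
        rwa [show x + i + 1 = x + 1 + i by ring] at this
    have hz : (Finset.univ.filter fun x => δ (x + i) = 0).card
        = (Finset.univ.filter fun x => δ x = 0).card :=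
      Finset.card_equiv (Equiv.addRight i) fun x => by simp
    simp only [hc]
    simp only [e, zero_add, hz]
  simp only [h1]
  rw [Finset.sum_comm]
  simp only [h2]
  rw [Finset.sum_const, Finset.card_univ, ZMod.card, nsmul_eq_mul]

/-- The signed number of permutations containing the edges of a coherent cyclic word of length `n`
with `m` zeros, divided by `m`. -/
def signedWeight (n m : ℕ) : ℚ := (-1) ^ (n - m) * n * ((m - 1).factorial : ℚ) / m

open Classical in
theorem A0_eq_sum_isCoherent (n : ℕ) [NeZero n] (hn : 3 ≤ n) :
    (A0 n : ℚ) = (∑ δ : ZMod n → SignType, if IsCoherent δ then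
      ((Finset.univ.filter fun x => δ x = 0).card : ℚ) *
        signedWeight n (Finset.univ.filter fun x => δ x = 0).card else 0) + (-1) ^ n * 2 * n := by
  have hconst : ∀ s : SignType, s ≠ 0 → IsCoherent (fun _ : ZMod n => s) := by
    intro s hs x
    change s * s ≠ -1
    clear x
    revert s
    decide
  have hterm : ∀ δ : ZMod n → SignType,
      (-1 : ℚ) ^ (Finset.univ.filter fun x => δ x ≠ 0).card
        * ((extensions n (orientedEdges δ)).card : ℚ)
      = (if IsCoherent δ then ((Finset.univ.filter fun x => δ x = 0).card : ℚ) *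
        signedWeight n (Finset.univ.filter fun x => δ x = 0).card else 0)
        + ((if δ = (fun _ => 1) then (-1 : ℚ) ^ n * n else 0)
        + (if δ = (fun _ => -1) then (-1 : ℚ) ^ n * n else 0)) := by
    intro δ
    have hcard : (Finset.univ.filter fun x => δ x = 0).card
        + (Finset.univ.filter fun x => δ x ≠ 0).card = n := by
      rw [Finset.card_filter_add_card_filter_not, Finset.card_univ, ZMod.card]
    by_cases hz : ∃ z, δ z = 0
    · obtain ⟨z, hz⟩ := hz
      have hne : ∀ s : SignType, s ≠ 0 → δ ≠ fun _ => s := by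
        rintro s hs rfl
        exact hs hz
      rw [if_neg (hne 1 (by decide)), if_neg (hne (-1) (by decide)), add_zero, add_zero]
      split_ifs with hδ
      · have hpos : 0 < (Finset.univ.filter fun x => δ x = 0).card :=
          Finset.card_pos.mpr ⟨z, by simp [hz]⟩
        rw [card_extensions (hδ.isPathSystem hn hz)
          (m := (Finset.univ.filter fun x => δ x = 0).card - 1)
          (by rw [card_orientedEdges hn]; lia)]
        generalize (Finset.univ.filter fun x => δ x = 0).card = m at *
        rw [signedWeight, show n - m = (Finset.univ.filter fun x => δ x ≠ 0).card by lia]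
        have : (m : ℚ) ≠ 0 := by positivity
        push_cast
        field_simp
      · rw [extensions_orientedEdges_of_not_isCoherent hn hδ]
        simp
    · push Not at hz
      have h0 : (Finset.univ.filter fun x => δ x = 0).card = 0 := by simpa using hz
      rw [h0, zero_add] at hcard
      by_cases hδ : IsCoherent δ
      · obtain ⟨s, hs, rfl⟩ : ∃ s : SignType, s ≠ 0 ∧ δ = fun _ => s :=
          ⟨δ 0, hz 0, hδ.eq_const hz⟩
        rw [hcard, h0, card_extensions_const hs]
        have hfun : ∀ t : SignType, ((fun _ : ZMod n => s) = fun _ => t) ↔ s = t :=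
          fun t => ⟨fun h => congrFun h 0, fun h => h ▸ rfl⟩
        simp only [hfun]
        rcases SignType.trichotomy s with rfl | rfl | rfl
        · simp
        · exact absurd rfl hs
        · simp
      · have hne : ∀ s : SignType, s ≠ 0 → δ ≠ fun _ => s := by
          rintro s hs rfl
          exact hδ (hconst s hs)
        rw [if_neg (hne 1 (by decide)), if_neg (hne (-1) (by decide)), if_neg hδ,
          extensions_orientedEdges_of_not_isCoherent hn hδ]
        simp
  rw [A0_eq_sum hn, Finset.sum_congr rfl fun δ _ => hterm δ, Finset.sum_add_distrib,
    Finset.sum_add_distrib, Finset.sum_ite_eq', Finset.sum_ite_eq']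
  simp only [Finset.mem_univ, if_true]
  ring

/-- The Aspvall–Liang formula for `a_{n,0}`, for `n ≥ 3`. -/
theorem a_n0_formula (n : ℕ) (hn : 3 ≤ n) :
    (A0 n : ℚ) =
      (∑ r ∈ Finset.range n, ∑ c ∈ Finset.range (r + 1),
        (-1 : ℚ) ^ r * 2 ^ c * (Nat.factorial (n - r) : ℚ) * (chooseShift r c : ℚ) *
          (Nat.choose (n - r) c : ℚ) * ((n : ℚ) / ((n : ℚ) - (r : ℚ))) ^ 2) +
        (-1 : ℚ) ^ n * 2 * (n : ℚ) := by
  obtain ⟨k, rfl⟩ : ∃ k, n = k + 1 := ⟨n - 1, by lia⟩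
  rw [A0_eq_sum_isCoherent (k + 1) hn, sum_isCoherent_mul (k + 1) (signedWeight (k + 1)),
    sum_isCoherent_zero k (signedWeight (k + 1)),
    ← Finset.Nat.sum_antidiagonal_swap, Finset.Nat.sum_antidiagonal_eq_sum_range_succ_mk,
    Finset.mul_sum]
  congr 1
  refine Finset.sum_congr rfl fun r hr => ?_
  obtain ⟨m, rfl⟩ : ∃ m, k = r + m := ⟨k - r, by have := Finset.mem_range.mp hr; lia⟩
  simp only [Prod.fst_swap, Prod.snd_swap, gapCount, signedWeight]
  rw [show r + m - r = m by lia, show r + m + 1 - (m + 1) = r by lia,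
    show r + m + 1 - r = m + 1 by lia, Nat.add_sub_cancel, Nat.factorial_succ]
  push_cast
  rw [Finset.sum_mul, Finset.mul_sum]
  refine Finset.sum_congr rfl fun c _ => ?_
  rw [show (r : ℚ) + m + 1 - r = m + 1 by ring]
  have : (m : ℚ) + 1 ≠ 0 := by positivity
  field_simp
end

section
/- For every fixed integer r ≥ 0, as n → ∞ one has n^{2r falling} / (n^{r falling})² = 1 − (r^{2 falling} + r)/n + (r^{4 falling} + 4·r^{3 falling} + 2·r^{2 falling})/(2n²) + O(1/n³), where m^{k falling} = m(m−1)⋯(m−k+1) denotes the falling factorial. -/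
open Filter Asymptotics

/-- The quotient `n^{2r falling} / (n^{r falling})²` has a second-order expansion in `1 / n`
whose remainder is `(1 / n)³` times a function of `1 / n` continuous at `0`. -/
theorem exists_descFactorial_ratio_expansion (r : ℕ) :
    ∃ c : ℝ → ℝ, ContinuousAt c 0 ∧ ∀ᶠ n : ℕ in atTop,
      (Nat.descFactorial n (2 * r) : ℝ) / (Nat.descFactorial n r : ℝ) ^ 2 =
        1 - (r : ℝ) ^ 2 * (n : ℝ)⁻¹ + (r : ℝ) ^ 2 * ((r : ℝ) - 1) ^ 2 / 2 * (n : ℝ)⁻¹ ^ 2 +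
          (n : ℝ)⁻¹ ^ 3 * c (n : ℝ)⁻¹ := by
  induction r with
  | zero => exact ⟨fun _ => 0, continuousAt_const, by simp⟩
  | succ r ih =>
    obtain ⟨c, hc, h⟩ := ih
    set ρ : ℝ := (r : ℝ) with hρ
    refine ⟨fun x => (c x * ((1 - 2 * ρ * x) * (1 - (2 * ρ + 1) * x)) +
      ((-ρ ^ 2 * (2 * ρ * (2 * ρ + 1)) - ρ ^ 2 * (ρ - 1) ^ 2 / 2 * (4 * ρ + 1) +
          (ρ + 1) ^ 2 * ρ ^ 2 + 2 * ρ * ((ρ + 1) ^ 2 * ρ ^ 2 / 2)) +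
        x * (ρ ^ 2 * (ρ - 1) ^ 2 / 2 * (2 * ρ * (2 * ρ + 1)) -
          (ρ + 1) ^ 2 * ρ ^ 2 / 2 * ρ ^ 2))) / (1 - ρ * x) ^ 2, ?_, ?_⟩
    · refine ContinuousAt.div (by fun_prop) (by fun_prop) (by simp)
    · filter_upwards [h, eventually_ge_atTop (2 * r + 2)] with n hn hge
      have hn0 : (n : ℝ) ≠ 0 := by
        have : n ≠ 0 := by omega
        exact_mod_cast this
      have hnr : (n : ℝ) - ρ ≠ 0 := by
        have : (r : ℝ) < n := by exact_mod_cast (by omega : r < n)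
        rw [hρ]
        linarith
      have hsub : (1 : ℝ) - ρ * (n : ℝ)⁻¹ ≠ 0 := by
        have : (1 : ℝ) - ρ * (n : ℝ)⁻¹ = (n - ρ) * (n : ℝ)⁻¹ := by field_simp
        rw [this]
        exact mul_ne_zero hnr (inv_ne_zero hn0)
      have hstep : (Nat.descFactorial n (2 * (r + 1)) : ℝ) / (Nat.descFactorial n (r + 1) : ℝ) ^ 2 =
          (Nat.descFactorial n (2 * r) : ℝ) / (Nat.descFactorial n r : ℝ) ^ 2 *
            (((1 - 2 * ρ * (n : ℝ)⁻¹) * (1 - (2 * ρ + 1) * (n : ℝ)⁻¹)) /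
              (1 - ρ * (n : ℝ)⁻¹) ^ 2) := by
        have hquot : ((1 - 2 * ρ * (n : ℝ)⁻¹) * (1 - (2 * ρ + 1) * (n : ℝ)⁻¹)) /
            (1 - ρ * (n : ℝ)⁻¹) ^ 2 =
              ((n - (2 * ρ + 1)) * (n - 2 * ρ)) / ((n : ℝ) - ρ) ^ 2 := by
          rw [div_eq_div_iff (pow_ne_zero 2 hsub) (pow_ne_zero 2 hnr)]
          field_simp
        rw [hquot, show 2 * (r + 1) = 2 * r + 1 + 1 by ring, Nat.descFactorial_succ,
          Nat.descFactorial_succ, Nat.descFactorial_succ]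
        push_cast [Nat.cast_sub (show 2 * r + 1 ≤ n by omega),
          Nat.cast_sub (show 2 * r ≤ n by omega), Nat.cast_sub (show r ≤ n by omega)]
        rw [div_mul_div_comm]
        congr 1 <;> ring
      rw [hstep, hn]
      push_cast
      rw [← hρ]
      generalize (n : ℝ)⁻¹ = x at hsub ⊢
      generalize c x = y
      field_simp
      ring

theorem Nat.cast_descFactorial_three {S : Type*} [CommRing S] (a : ℕ) :
    (a.descFactorial 3 : S) = a * (a - 1) * (a - 2) := by
  rw [← descPochhammer_eval_eq_descFactorial]
  simp [descPochhammer_succ_right]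

theorem Nat.cast_descFactorial_four {S : Type*} [CommRing S] (a : ℕ) :
    (a.descFactorial 4 : S) = a * (a - 1) * (a - 2) * (a - 3) := by
  rw [← descPochhammer_eval_eq_descFactorial]
  simp [descPochhammer_succ_right]

/-- For fixed `r ≥ 0`, as `n → ∞`,
`n^{2r falling}/(n^{r falling})² = 1 − (r^{2f} + r)/n + (r^{4f} + 4r^{3f} + 2r^{2f})/(2n²) + O(1/n³)`. -/
theorem falling_ratio_asymptotics (r : ℕ) :
    (fun n : ℕ => (Nat.descFactorial n (2 * r) : ℝ) / (Nat.descFactorial n r : ℝ) ^ 2 -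
        (1 - ((Nat.descFactorial r 2 : ℝ) + (r : ℝ)) / (n : ℝ) +
          ((Nat.descFactorial r 4 : ℝ) + 4 * (Nat.descFactorial r 3 : ℝ) +
            2 * (Nat.descFactorial r 2 : ℝ)) / (2 * (n : ℝ) ^ 2))) =O[atTop]
      (fun n : ℕ => 1 / (n : ℝ) ^ 3) := by
  obtain ⟨c, hc, h⟩ := exists_descFactorial_ratio_expansion r
  have hbdd : (fun n : ℕ => c (n : ℝ)⁻¹) =O[atTop] fun _ => (1 : ℝ) :=
    (hc.tendsto.comp (tendsto_inv_atTop_nhds_zero_nat (𝕜 := ℝ))).isBigO_one ℝ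
  refine ((isBigO_refl (fun n : ℕ => 1 / (n : ℝ) ^ 3) atTop).mul hbdd).congr' ?_ (by simp)
  filter_upwards [h] with n hn
  rw [hn, Nat.cast_descFactorial_two, Nat.cast_descFactorial_three, Nat.cast_descFactorial_four]
  ring
end

section
/- For every fixed integer r ≥ 1, as n → ∞ one has (r−1) · n^{(2r−1) falling} / (n^{r falling})² = (r−1)/n − ((r−1)^{3 falling} + 3·(r−1)^{2 falling} + (r−1))/n² + O(1/n³), where m^{k falling} = m(m−1)⋯(m−k+1) denotes the falling factorial. -/
open Filter Asymptotics

/-- Second-order expansion of the falling factorial in powers of `1 / n`, with an exact remainder. -/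
theorem exists_continuous_descFactorial_eq (k : ℕ) :
    ∃ R : ℝ → ℝ, Continuous R ∧ ∀ n : ℕ, 0 < n → (n.descFactorial k : ℝ) =
      (n : ℝ) ^ k * (1 - (k * (k - 1) / 2 : ℝ) * (n : ℝ)⁻¹ + (n : ℝ)⁻¹ ^ 2 * R (n : ℝ)⁻¹) := by
  induction k with
  | zero => exact ⟨fun _ => 0, continuous_const, fun n _ => by simp⟩
  | succ k ih =>
    obtain ⟨R, hR, h⟩ := ih
    refine ⟨fun x => (k * (k - 1) / 2 : ℝ) * k + R x * (1 - k * x), by fun_prop, fun n hn => ?_⟩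
    have hmul : (n.descFactorial (k + 1) : ℝ) = (n - k) * n.descFactorial k := by
      rcases le_or_gt k n with hkn | hkn
      · rw [Nat.descFactorial_succ, Nat.cast_mul, Nat.cast_sub hkn]
      · simp [Nat.descFactorial_succ, Nat.descFactorial_eq_zero_iff_lt.2 hkn]
    have hn' : (n : ℝ) ≠ 0 := by positivity
    have hfac : (n : ℝ) - k = n * (1 - k * (n : ℝ)⁻¹) := by field_simp
    rw [hmul, h n hn, hfac]
    push_cast
    ring

theorem descFactorial_three_add_eq_pow (s : ℕ) :
    s.descFactorial 3 + 3 * s.descFactorial 2 + s = s ^ 3 := by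
  rcases s with _ | _ | s
  · rfl
  · rfl
  · simp only [Nat.descFactorial_succ, Nat.descFactorial_zero, Nat.sub_zero,
      show s + 1 + 1 - 1 = s + 1 by lia, show s + 1 + 1 - 2 = s by lia]
    ring

/-- For fixed `r ≥ 1`, as `n → ∞`,
`(r−1)·n^{(2r−1) falling}/(n^{r falling})² = (r−1)/n − ((r−1)^{3f} + 3(r−1)^{2f} + (r−1))/n² + O(1/n³)`. -/
theorem falling_ratio_asymptotics' (r : ℕ) (hr : 1 ≤ r) :
    (fun n : ℕ => ((r : ℝ) - 1) * (Nat.descFactorial n (2 * r - 1) : ℝ) /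
          (Nat.descFactorial n r : ℝ) ^ 2 -
        (((r : ℝ) - 1) / (n : ℝ) -
          ((Nat.descFactorial (r - 1) 3 : ℝ) + 3 * (Nat.descFactorial (r - 1) 2 : ℝ) +
            ((r : ℝ) - 1)) / (n : ℝ) ^ 2)) =O[atTop]
      (fun n : ℕ => 1 / (n : ℝ) ^ 3) := by
  obtain ⟨s, rfl⟩ : ∃ s, r = s + 1 := ⟨r - 1, by lia⟩
  have hcube : (s.descFactorial 3 : ℝ) + 3 * (s.descFactorial 2 : ℝ) + s = (s : ℝ) ^ 3 := by
    exact_mod_cast descFactorial_three_add_eq_pow s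
  obtain ⟨P, hP, hnum⟩ := exists_continuous_descFactorial_eq (2 * s + 1)
  obtain ⟨Q, hQ, hden⟩ := exists_continuous_descFactorial_eq (s + 1)
  have hinv : Tendsto (fun n : ℕ => (n : ℝ)⁻¹) atTop (nhds 0) := tendsto_inv_atTop_nhds_zero_nat
  let c : ℝ := s * (s + 1) / 2
  let B : ℝ → ℝ := fun x => 1 - c * x + x ^ 2 * Q x
  -- `B x ^ 2 = 1 - 2 * c * x + x ^ 2 * E x`
  let E : ℝ → ℝ := fun x => c ^ 2 + 2 * Q x * (1 - c * x) + x ^ 2 * Q x ^ 2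
  let G : ℝ → ℝ := fun x => s * (P x - E x - 2 * c * s ^ 2 + s ^ 2 * x * E x)
  have hB : Continuous B := by fun_prop
  have hG : Continuous G := by fun_prop
  have hB0 : B 0 ≠ 0 := by simp [B]
  have hbdd : (fun n : ℕ => G (n : ℝ)⁻¹ / B (n : ℝ)⁻¹ ^ 2) =O[atTop] (fun _ => (1 : ℝ)) :=
    ((hG.continuousAt.div (hB.pow 2).continuousAt (pow_ne_zero 2 hB0)).tendsto.comp
      hinv).isBigO_one ℝ
  have hmul := (isBigO_refl (fun n : ℕ => 1 / (n : ℝ) ^ 3) atTop).mul hbdd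
  simp only [mul_one] at hmul
  refine hmul.congr' ?_ EventuallyEq.rfl
  filter_upwards [eventually_gt_atTop 0,
    hinv.eventually (hB.continuousAt.eventually_ne hB0)] with n hn hBn
  have hn' : (n : ℝ) ≠ 0 := by positivity
  have hden' : (n.descFactorial (s + 1) : ℝ) = (n : ℝ) ^ (s + 1) * B (n : ℝ)⁻¹ := by
    rw [hden n hn]
    simp only [B, c]
    push_cast
    ring
  rw [show 2 * (s + 1) - 1 = 2 * s + 1 by lia, Nat.add_sub_cancel, hnum n hn, hden']
  push_cast
  rw [add_sub_cancel_right, hcube]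
  generalize hx : (n : ℝ)⁻¹ = x at *
  have hnx : (n : ℝ) = x⁻¹ := by rw [← hx, inv_inv]
  have hx0 : x ≠ 0 := by rw [← hx]; exact inv_ne_zero hn'
  have hratio : ∀ a : ℝ, (s : ℝ) * ((n : ℝ) ^ (2 * s + 1) * a) / ((n : ℝ) ^ (s + 1) * B x) ^ 2 =
      s * x * a / B x ^ 2 := fun a => by
    rw [← hx] at hBn ⊢
    field_simp
    ring
  rw [hratio, hnx]
  field_simp
  simp only [G, E, B, c]
  ring
end

section
/- Fix integers d ≥ 2 and r ≥ 0, and let L_r = [1,1,…,1] be the list consisting of r ones. Then, as n → ∞ along multiples of d, q_{n,d}(L_r) = n^r · (1 − ((3/2)·r(r−1) + d·r)/n + O(1/n²)). -/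
open Filter Asymptotics

/-- `n_k`: the number of `i` with `1 ≤ i ≤ n` and `i ≡ k (mod d)`
(for `k = d` this is the residue class of `0`). -/
def nk (n d k : ℕ) : ℕ := ((Finset.Icc 1 n).filter (fun i => i % d = k % d)).card

/-- `q_{n,d}(L) = Σ_f Π_{k=1}^{d} C(n_k − Σ_{i∈f⁻¹(k)} l_i, |f⁻¹(k)|) · |f⁻¹(k)|!`, the sum
running over all `f : {1,…,c} → {1,…,d}` with `n_k ≥ Σ_{i∈f⁻¹(k)} l_i` for every `k`. -/
def q (n d : ℕ) (L : List ℕ) : ℕ :=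
  ∑ f : Fin L.length → Fin d,
    if ∀ k : Fin d,
        (∑ i ∈ Finset.univ.filter (fun i => f i = k), L.get i) ≤ nk n d ((k : ℕ) + 1) then
      ∏ k : Fin d,
        Nat.choose
            (nk n d ((k : ℕ) + 1) - ∑ i ∈ Finset.univ.filter (fun i => f i = k), L.get i)
            ((Finset.univ.filter (fun i => f i = k)).card) *
          Nat.factorial ((Finset.univ.filter (fun i => f i = k)).card)
    else 0

lemma nk_mul (d m k : ℕ) (hd : 0 < d) : nk (d * m) d k = m := by
  have h := Nat.Ioc_filter_modEq_card 0 (d * m) hd k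
  have hd' : (d : ℚ) ≠ 0 := by positivity
  have hI : Finset.Icc 1 (d * m) = Finset.Ioc 0 (d * m) := by
    ext; simp [Nat.succ_le_iff]
  have h2 : (((d * m : ℕ) : ℚ) - k) / d = ((0 : ℕ) - k : ℚ) / d + (m : ℕ) := by
    push_cast; field_simp; ring
  rw [h2, Int.floor_add_natCast] at h
  unfold nk
  rw [hI]
  simp only [Nat.ModEq] at h
  have h3 : ∀ a : ℤ, max (a + (m : ℤ) - a) 0 = m := by intro a; omega
  rw [h3] at h
  exact_mod_cast h

/-- The number of indices that `f` sends to `k`. -/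
def fiberCard {c d : ℕ} (f : Fin c → Fin d) (k : Fin d) : ℕ :=
  (Finset.univ.filter (fun i => f i = k)).card

lemma fiberCard_le {c d : ℕ} (f : Fin c → Fin d) (k : Fin d) : fiberCard f k ≤ c :=
  (Finset.card_filter_le _ _).trans_eq (by simp)

lemma sum_fiberCard {c d : ℕ} (f : Fin c → Fin d) : ∑ k, fiberCard f k = c := by
  simpa [fiberCard] using
    (Finset.card_eq_sum_card_fiberwise (f := f) (s := Finset.univ) (t := Finset.univ)
      (by simp)).symm

lemma fiberCard_cons {c d : ℕ} (x : Fin d) (f : Fin c → Fin d) (k : Fin d) :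
    fiberCard (Fin.cons x f : Fin (c + 1) → Fin d) k = (if x = k then 1 else 0) + fiberCard f k := by
  simp only [fiberCard, Finset.card_filter, Fin.sum_univ_succ, Fin.cons_zero, Fin.cons_succ]

lemma q_of_forall_get_eq_one (d m : ℕ) (hd : 0 < d) (L : List ℕ) (hL : ∀ i, L.get i = 1)
    (hm : L.length ≤ m) :
    q (d * m) d L =
      ∑ f : Fin L.length → Fin d, ∏ k, (m - fiberCard f k).descFactorial (fiberCard f k) := by
  unfold q
  refine Finset.sum_congr rfl fun f _ => ?_
  have hs : ∀ k, ∑ i ∈ Finset.univ.filter (fun i => f i = k), L.get i = fiberCard f k := by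
    intro k
    simp only [hL]
    simp [fiberCard]
  simp only [hs, nk_mul _ _ _ hd]
  rw [if_pos fun k => (fiberCard_le f k).trans hm]
  refine Finset.prod_congr rfl fun k _ => ?_
  rw [Nat.descFactorial_eq_factorial_mul_choose, mul_comm]
  rfl

lemma q_replicate_one (d m r : ℕ) (hd : 0 < d) (hm : r ≤ m) :
    q (d * m) d (List.replicate r 1) =
      ∑ f : Fin r → Fin d, ∏ k, (m - fiberCard f k).descFactorial (fiberCard f k) := by
  have h := q_of_forall_get_eq_one d m hd (List.replicate r 1) (by simp) (by simpa using hm)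
  rw [h, List.length_replicate]

lemma cast_descFactorial_sub_self (m a : ℕ) (hm : 2 * a ≤ m) (h0 : 0 < m) :
    ((m - a).descFactorial a : ℝ) =
      (m : ℝ) ^ a * ∏ j ∈ Finset.range a, (1 - ((a : ℝ) + j) * (m : ℝ)⁻¹) := by
  have hm' : (m : ℝ) ≠ 0 := by positivity
  have hc : (m : ℝ) ^ a = ∏ _j ∈ Finset.range a, (m : ℝ) := by simp
  rw [Nat.descFactorial_eq_prod_range, hc, ← Finset.prod_mul_distrib, Nat.cast_prod]
  refine Finset.prod_congr rfl fun j hj => ?_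
  rw [Finset.mem_range] at hj
  rw [Nat.cast_sub (by omega), Nat.cast_sub (by omega)]
  field_simp
  ring

lemma exists_continuous_prod_eq {ι : Type*} (s : Finset ι) (c : ι → ℝ) :
    ∃ g : ℝ → ℝ, Continuous g ∧
      ∀ x, ∏ i ∈ s, (1 - c i * x) = 1 - (∑ i ∈ s, c i) * x + x ^ 2 * g x := by
  classical
  induction s using Finset.induction_on with
  | empty => exact ⟨0, continuous_zero, by simp⟩
  | insert a s ha ih =>
    obtain ⟨g, hg, h⟩ := ih
    refine ⟨fun x => g x * (1 - c a * x) + c a * ∑ i ∈ s, c i, by fun_prop, fun x => ?_⟩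
    rw [Finset.prod_insert ha, Finset.sum_insert ha, h]
    ring

lemma sum_sum_fiberCard_sq (d r : ℕ) :
    (d : ℝ) * ∑ f : Fin r → Fin d, ∑ k, (fiberCard f k : ℝ) ^ 2 =
      (d : ℝ) ^ r * (r * (r - 1) + d * r) := by
  induction r with
  | zero => simp [fiberCard]
  | succ r ih =>
    have hs : ∀ f : Fin r → Fin d, ∑ k, (fiberCard f k : ℝ) = r := fun f => by
      exact_mod_cast sum_fiberCard f
    have key : ∀ f : Fin r → Fin d, ∑ x : Fin d,
        ∑ k, (fiberCard (Fin.cons x f : Fin (r + 1) → Fin d) k : ℝ) ^ 2 =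
          d * ∑ k, (fiberCard f k : ℝ) ^ 2 + (2 * r + d) := by
      intro f
      have : ∀ x : Fin d, ∑ k, (fiberCard (Fin.cons x f : Fin (r + 1) → Fin d) k : ℝ) ^ 2 =
          ∑ k, (fiberCard f k : ℝ) ^ 2 + 2 * fiberCard f x + 1 := by
        intro x
        have h1 : ∀ k, (fiberCard (Fin.cons x f : Fin (r + 1) → Fin d) k : ℝ) ^ 2 =
            (fiberCard f k : ℝ) ^ 2 + (if x = k then 2 * (fiberCard f k : ℝ) + 1 else 0) := by
          intro k
          rw [fiberCard_cons]
          split_ifs <;> push_cast <;> ring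
        simp only [h1, Finset.sum_add_distrib, Finset.sum_ite_eq, Finset.mem_univ, if_true]
        ring
      simp only [this, Finset.sum_add_distrib, ← Finset.mul_sum, hs]
      simp
      ring
    rw [← (Fin.consEquiv fun _ => Fin d).sum_comp, Fintype.sum_prod_type_right]
    simp only [Fin.consEquiv, Equiv.coe_fn_mk]
    rw [Finset.sum_congr rfl fun f _ => key f, Finset.sum_add_distrib, ← Finset.mul_sum, ih]
    simp
    ring

lemma sum_range_add_self (a : ℕ) :
    ∑ j ∈ Finset.range a, ((a : ℝ) + j) = (3 * (a : ℝ) ^ 2 - a) / 2 := by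
  have h : ∀ b : ℕ, ∑ j ∈ Finset.range b, ((a : ℝ) + j) = a * b + (b : ℝ) * (b - 1) / 2 := by
    intro b
    induction b with
    | zero => simp
    | succ b ih => rw [Finset.sum_range_succ, ih]; push_cast; ring
  rw [h]; ring

lemma exists_continuous_q_replicate_one (d r : ℕ) (hd : 0 < d) :
    ∃ g : ℝ → ℝ, Continuous g ∧ ∀ m : ℕ, 0 < m → 2 * r ≤ m →
      (q (d * m) d (List.replicate r 1) : ℝ) / ((d * m : ℕ) : ℝ) ^ r =
        1 - ((3 / 2) * (r : ℝ) * ((r : ℝ) - 1) + (d : ℝ) * (r : ℝ)) / ((d * m : ℕ) : ℝ) +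
          ((m : ℝ)⁻¹) ^ 2 * g (m : ℝ)⁻¹ := by
  have hf : ∀ f : Fin r → Fin d, ∃ g : ℝ → ℝ, Continuous g ∧ ∀ x,
      ∏ k, ∏ j ∈ Finset.range (fiberCard f k), (1 - ((fiberCard f k : ℝ) + j) * x) =
        1 - (∑ k, (3 * (fiberCard f k : ℝ) ^ 2 - fiberCard f k) / 2) * x + x ^ 2 * g x := by
    intro f
    obtain ⟨g, hg, h⟩ := exists_continuous_prod_eq
      (Finset.univ.sigma fun k => Finset.range (fiberCard f k))
      (fun p : (_ : Fin d) × ℕ => (fiberCard f p.1 : ℝ) + p.2)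
    refine ⟨g, hg, fun x => ?_⟩
    have := h x
    rw [Finset.prod_sigma, Finset.sum_sigma] at this
    simpa only [sum_range_add_self] using this
  choose g hg h using hf
  have hS : (d : ℝ) * ∑ f : Fin r → Fin d,
      ∑ k, (3 * (fiberCard f k : ℝ) ^ 2 - fiberCard f k) / 2 =
        (d : ℝ) ^ r * ((3 / 2) * (r : ℝ) * ((r : ℝ) - 1) + (d : ℝ) * (r : ℝ)) := by
    have hs : ∀ f : Fin r → Fin d, ∑ k, (fiberCard f k : ℝ) = r := fun f => by
      exact_mod_cast sum_fiberCard f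
    have h2 := sum_sum_fiberCard_sq d r
    simp only [← Finset.sum_div, Finset.sum_sub_distrib, ← Finset.mul_sum, hs]
    simp
    linear_combination (3 / 2 : ℝ) * h2
  refine ⟨fun x => (∑ f, g f x) / (d : ℝ) ^ r,
    (continuous_finsetSum _ fun f _ => hg f).div_const _, fun m h0 hm => ?_⟩
  have hq : (q (d * m) d (List.replicate r 1) : ℝ) = (m : ℝ) ^ r *
      ((d : ℝ) ^ r - (∑ f : Fin r → Fin d,
        ∑ k, (3 * (fiberCard f k : ℝ) ^ 2 - fiberCard f k) / 2) * (m : ℝ)⁻¹ +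
          ((m : ℝ)⁻¹) ^ 2 * ∑ f, g f (m : ℝ)⁻¹) := by
    rw [q_replicate_one d m r hd (by omega)]
    push_cast
    have : ∀ f : Fin r → Fin d,
        ∏ k, ((m - fiberCard f k).descFactorial (fiberCard f k) : ℝ) = (m : ℝ) ^ r *
          (1 - (∑ k, (3 * (fiberCard f k : ℝ) ^ 2 - fiberCard f k) / 2) * (m : ℝ)⁻¹ +
            ((m : ℝ)⁻¹) ^ 2 * g f (m : ℝ)⁻¹) := by
      intro f
      rw [← h, Finset.prod_congr rfl fun k _ => cast_descFactorial_sub_self m (fiberCard f k)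
        (by have := fiberCard_le f k; omega) h0, Finset.prod_mul_distrib,
        Finset.prod_pow_eq_pow_sum, sum_fiberCard]
    rw [Finset.sum_congr rfl fun f _ => this f, ← Finset.mul_sum, Finset.sum_add_distrib,
      Finset.sum_sub_distrib, ← Finset.sum_mul, ← Finset.mul_sum]
    simp
  have hd' : (d : ℝ) ≠ 0 := by positivity
  have hm' : (m : ℝ) ≠ 0 := by positivity
  rw [hq, eq_div_of_mul_eq hd' ((mul_comm _ _).trans hS)]
  push_cast
  rw [mul_pow]
  field_simp

/-- For fixed `d ≥ 2` and `r ≥ 0`, as `n → ∞` along multiples of `d`,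
`q_{n,d}([1,…,1]) = n^r·(1 − ((3/2)r(r−1) + dr)/n + O(1/n²))`, the list having `r` ones. -/
theorem q_ones_asymptotics (d r : ℕ) (hd : 2 ≤ d) :
    (fun n : ℕ => (q n d (List.replicate r 1) : ℝ) / (n : ℝ) ^ r -
        (1 - ((3 / 2) * (r : ℝ) * ((r : ℝ) - 1) + (d : ℝ) * (r : ℝ)) / (n : ℝ)))
      =O[atTop ⊓ Filter.principal {n : ℕ | d ∣ n}]
      (fun n : ℕ => 1 / (n : ℝ) ^ 2) := by
  have hd0 : 0 < d := by omega
  obtain ⟨g, hg, h⟩ := exists_continuous_q_replicate_one d r hd0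
  obtain ⟨C, hC⟩ := (isCompact_Icc (a := (0 : ℝ)) (b := 1)).exists_bound_of_continuousOn
    hg.continuousOn
  refine IsBigO.of_bound (C * (d : ℝ) ^ 2) ?_
  rw [eventually_inf_principal]
  filter_upwards [eventually_ge_atTop (d * (2 * r + 1))] with n hn hdn
  obtain ⟨m, rfl⟩ := hdn
  have hm : 2 * r + 1 ≤ m := Nat.le_of_mul_le_mul_left hn hd0
  have hm1 : (1 : ℝ) ≤ m := by exact_mod_cast (by omega : 1 ≤ m)
  have hb := hC (m : ℝ)⁻¹ ⟨by positivity, inv_le_one_of_one_le₀ hm1⟩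
  have hd' : (d : ℝ) ≠ 0 := by positivity
  rw [h m (by omega) (by omega), add_sub_cancel_left, norm_mul,
    Real.norm_of_nonneg (by positivity : (0 : ℝ) ≤ ((m : ℝ)⁻¹) ^ 2),
    Real.norm_of_nonneg (by positivity : (0 : ℝ) ≤ 1 / ((d * m : ℕ) : ℝ) ^ 2)]
  calc ((m : ℝ)⁻¹) ^ 2 * ‖g (m : ℝ)⁻¹‖ ≤ ((m : ℝ)⁻¹) ^ 2 * C := by gcongr
    _ = C * (d : ℝ) ^ 2 * (1 / ((d * m : ℕ) : ℝ) ^ 2) := by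
      push_cast
      field_simp
end

section
/- Fix integers d ≥ 2 and r ≥ 2, and let L = [1,1,…,1,2] be the list consisting of r−2 ones followed by a single 2 (so L has length r−1 and its entries sum to r). Then, as n → ∞ along multiples of d, q_{n,d}(L) / n^{r−1} → 1. -/
open Filter Asymptotics

/-- When `d ∣ n`, every residue class modulo `d` has `n / d` members in `{1, …, n}`. -/
theorem nk_eq_div {n d : ℕ} (hd : 0 < d) (h : d ∣ n) (k : ℕ) : nk n d k = n / d := by
  obtain ⟨m, rfl⟩ := h
  have key := Nat.Ioc_filter_modEq_card 0 (d * m) hd k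
  have hd' : (d : ℚ) ≠ 0 := by positivity
  have e : (((d * m : ℕ) : ℚ) - k) / d = ((0 : ℕ) - k : ℚ) / d + (m : ℕ) := by
    push_cast
    field_simp
    ring
  rw [e, Int.floor_add_natCast, add_sub_cancel_left, max_eq_left (by positivity)] at key
  rw [Nat.mul_div_cancel_left m hd]
  exact_mod_cast key

/-- `(n / d - s) / n → 1 / d` along the multiples of `d`. -/
theorem tendsto_div_sub_div {d : ℕ} (hd : 0 < d) (s : ℕ) :
    Tendsto (fun n : ℕ => ((n / d - s : ℕ) : ℝ) / n) (atTop ⊓ Filter.principal {n : ℕ | d ∣ n})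
      (nhds (1 / d : ℝ)) := by
  have h : Tendsto (fun n : ℕ => (1 / d : ℝ) - s / (n : ℝ)) (atTop ⊓ Filter.principal {n : ℕ | d ∣ n})
      (nhds (1 / d : ℝ)) := by
    simpa using (tendsto_const_nhds.sub
      (tendsto_const_div_atTop_nhds_zero_nat (s : ℝ))).mono_left inf_le_left
  refine h.congr' ?_
  filter_upwards [mem_inf_of_left (eventually_ge_atTop (d * s + 1)),
    mem_inf_of_right (mem_principal_self _)] with n hn hdn
  obtain ⟨m, rfl⟩ := hdn
  have hn : d * s + 1 ≤ d * m := hn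
  have hsm : s ≤ m := le_of_mul_le_mul_left (by omega) hd
  have hm : (m : ℝ) ≠ 0 := by
    rintro h0
    have : m = 0 := by exact_mod_cast h0
    subst this
    omega
  have hd' : (d : ℝ) ≠ 0 := by positivity
  rw [Nat.mul_div_cancel_left m hd, Nat.cast_sub hsm]
  push_cast
  field_simp

/-- The falling factorial of `n / d - s` of length `a` is asymptotic to `(n / d) ^ a`. -/
theorem tendsto_descFactorial_div_pow {d : ℕ} (hd : 0 < d) (s a : ℕ) :
    Tendsto (fun n : ℕ => ((n / d - s).descFactorial a : ℝ) / (n : ℝ) ^ a)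
      (atTop ⊓ Filter.principal {n : ℕ | d ∣ n}) (nhds ((1 / d : ℝ) ^ a)) := by
  induction a with
  | zero => simpa using tendsto_const_nhds
  | succ a ih =>
    have h := (tendsto_div_sub_div hd (s + a)).mul ih
    rw [← pow_succ'] at h
    refine h.congr fun n => ?_
    rw [Nat.descFactorial_succ, Nat.sub_sub, pow_succ', Nat.cast_mul, mul_div_mul_comm]

/-- For every list `L` of length `c`, `q_{n,d}(L) / n ^ c → 1` along the multiples of `d`. -/
theorem q_div_pow_tendsto {d : ℕ} (hd : 0 < d) (L : List ℕ) :
    Tendsto (fun n : ℕ => (q n d L : ℝ) / (n : ℝ) ^ L.length)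
      (atTop ⊓ Filter.principal {n : ℕ | d ∣ n}) (nhds 1) := by
  have hcard (f : Fin L.length → Fin d) :
      ∑ k : Fin d, (Finset.univ.filter (fun i => f i = k)).card = L.length := by
    rw [← Finset.card_eq_sum_card_fiberwise (by simp)]
    simp
  have hd' : (d : ℝ) ≠ 0 := by positivity
  have h := tendsto_finsetSum (Finset.univ : Finset (Fin L.length → Fin d)) fun f _ =>
    tendsto_finsetProd (Finset.univ : Finset (Fin d)) fun k _ =>
      tendsto_descFactorial_div_pow hd (∑ i ∈ Finset.univ.filter (fun i => f i = k), L.get i)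
        (Finset.univ.filter (fun i => f i = k)).card
  have hlim : ∑ f : Fin L.length → Fin d, ∏ k : Fin d,
      (1 / d : ℝ) ^ (Finset.univ.filter (fun i => f i = k)).card = 1 := by
    simp_rw [Finset.prod_pow_eq_pow_sum, hcard]
    simp [hd']
  rw [hlim] at h
  refine h.congr' ?_
  filter_upwards [mem_inf_of_left (eventually_ge_atTop (d * ∑ i, L.get i)),
    mem_inf_of_right (mem_principal_self _)] with n hn hdn
  have hS : ∑ i, L.get i ≤ n / d := (Nat.le_div_iff_mul_le hd).2 (by rw [mul_comm]; exact hn)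
  rw [q, Nat.cast_sum, Finset.sum_div]
  refine Finset.sum_congr rfl fun f _ => ?_
  simp_rw [nk_eq_div hd hdn]
  rw [if_pos fun k => (Finset.sum_le_sum_of_subset (Finset.filter_subset _ _)).trans hS,
    Finset.prod_div_distrib, Finset.prod_pow_eq_pow_sum, hcard, Nat.cast_prod]
  simp_rw [Nat.descFactorial_eq_factorial_mul_choose, mul_comm (Nat.factorial _)]

/-- For fixed `d ≥ 2` and `r ≥ 2`, as `n → ∞` along multiples of `d`,
`q_{n,d}([1,…,1,2]) / n^{r−1} → 1`, the list having `r−2` ones followed by one `2`. -/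
theorem q_ones_two_tendsto (d r : ℕ) (hd : 2 ≤ d) (hr : 2 ≤ r) :
    Filter.Tendsto
      (fun n : ℕ => (q n d (List.replicate (r - 2) 1 ++ [2]) : ℝ) / (n : ℝ) ^ (r - 1))
      (Filter.atTop ⊓ Filter.principal {n : ℕ | d ∣ n}) (nhds 1) := by
  have hlen : (List.replicate (r - 2) 1 ++ [2]).length = r - 1 := by
    simp
    omega
  rw [← hlen]
  exact q_div_pow_tendsto (by omega : 0 < d) (List.replicate (r - 2) 1 ++ [2])
end
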